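/- arXiv:math/0406250 — 2 statements merged into one kernel-verified Lean document; each statement's English description precedes it below -/
import Mathlib

section
/- Let λ/μ be an edgewise connected skew diagram, Π an outside decomposition of λ/μ, and ω_i a twist transformation for a non-maximal content i of λ/μ. Then D(Π) = D(ω_i(Π)), where for an outside decomposition Σ = (σ_1, …, σ_n) indexed so that q(σ_1) > ⋯ > q(σ_n), with p_1 > ⋯ > p_n the decreasing rearrangement of p(σ_1), …, p(σ_n), one defines D(Σ) = (−1)^{inv(Σ)} det(N) with N the n×n matrix whose (k,l) entry is s_{φ(Σ)[p_l, q(σ_k)]} when p_l ≤ q(σ_k)+1 (with s_{φ(Σ)[q+1,q]} = 1) and 0 when p_l > q(σ_k)+1. -/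
noncomputable section

/-- A box in the plane: `(row, column)`, rows increasing downward (English notation). -/
abbrev Box : Type := ℤ × ℤ

/-- The content of a box `(i, j)` is `j - i`. -/
def boxContent (b : Box) : ℤ := b.2 - b.1

/-- An integer partition, indexed from `1` (the value `part 0` is irrelevant). -/
structure Partition' where
  part : ℕ → ℕ
  antitone : ∀ ⦃i j : ℕ⦄, i ≤ j → part j ≤ part i
  eventually_zero : ∃ N : ℕ, ∀ i : ℕ, N ≤ i → part i = 0

/-- The skew diagram `λ/μ`: boxes `(i, j)` with `i ≥ 1` and `μ_i < j ≤ λ_i`. -/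
def skewCells (lam mu : Partition') : Set Box :=
  {b : Box | 1 ≤ b.1 ∧ (mu.part b.1.toNat : ℤ) < b.2 ∧ b.2 ≤ (lam.part b.1.toNat : ℤ)}

/-- `D` is the set of boxes of a skew diagram `λ/μ` for some partitions `μ ⊆ λ`. -/
def IsSkewShape (D : Set Box) : Prop :=
  ∃ lam mu : Partition', (∀ i, mu.part i ≤ lam.part i) ∧ D = skewCells lam mu

/-- Translate a set of boxes by a vector `v`. -/
def boxTranslate (v : Box) (D : Set Box) : Set Box := (fun b => b + v) '' D

/-- `D` is a translate of a skew diagram. -/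
def IsSkewLike (D : Set Box) : Prop := ∃ v : Box, IsSkewShape (boxTranslate v D)

/-- Two boxes share a common edge. -/
def boxAdj (a b : Box) : Prop :=
  (a.1 = b.1 ∧ (a.2 = b.2 + 1 ∨ b.2 = a.2 + 1)) ∨
  (a.2 = b.2 ∧ (a.1 = b.1 + 1 ∨ b.1 = a.1 + 1))

/-- Any two boxes of `D` are joined by a path of boxes of `D` in which consecutive
boxes share a common edge. -/
def EdgewiseConnected (D : Set Box) : Prop :=
  ∀ a ∈ D, ∀ b ∈ D, Relation.ReflTransGen (fun x y => x ∈ D ∧ y ∈ D ∧ boxAdj x y) a b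

/-- `D` contains no `2 × 2` block of boxes. -/
def NoTwoByTwo (D : Set Box) : Prop :=
  ∀ b : Box, ¬(b ∈ D ∧ (b.1, b.2 + 1) ∈ D ∧ (b.1 + 1, b.2) ∈ D ∧ (b.1 + 1, b.2 + 1) ∈ D)

/-- A border strip (ribbon): a nonempty edgewise connected skew diagram (up to translation)
containing no `2 × 2` block of boxes. -/
def IsBorderStrip (B : Set Box) : Prop :=
  B.Nonempty ∧ IsSkewLike B ∧ EdgewiseConnected B ∧ NoTwoByTwo B

/-- `b` is the starting box (lower-left end) of `B`: no box of `B` directly to its left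
nor directly below it. -/
def IsStartBox (B : Set Box) (b : Box) : Prop :=
  b ∈ B ∧ (b.1, b.2 - 1) ∉ B ∧ (b.1 + 1, b.2) ∉ B

/-- `b` is the ending box (upper-right end) of `B`: no box of `B` directly above it
nor directly to its right. -/
def IsEndBox (B : Set Box) (b : Box) : Prop :=
  b ∈ B ∧ (b.1 - 1, b.2) ∉ B ∧ (b.1, b.2 + 1) ∉ B

/-- The strip `B` has starting box of content `p` and ending box of content `q`. -/
def HasPQ (B : Set Box) (p q : ℤ) : Prop :=
  (∃ b : Box, IsStartBox B b ∧ boxContent b = p) ∧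
  (∃ b : Box, IsEndBox B b ∧ boxContent b = q)

/-- An outside decomposition of `D`: a partition of the boxes of `D` into pairwise disjoint
border strips, each strip having its starting box on the left or bottom perimeter of `D` and
its ending box on the right or top perimeter of `D`. -/
def IsOutsideDecomposition (D : Set Box) (P : Set (Set Box)) : Prop :=
  (∀ θ ∈ P, IsBorderStrip θ ∧ θ ⊆ D) ∧
  (∀ b ∈ D, ∃! θ : Set Box, θ ∈ P ∧ b ∈ θ) ∧
  (∀ θ ∈ P, ∀ b : Box, IsStartBox θ b → ((b.1, b.2 - 1) ∉ D ∨ (b.1 + 1, b.2) ∉ D)) ∧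
  (∀ θ ∈ P, ∀ b : Box, IsEndBox θ b → ((b.1 - 1, b.2) ∉ D ∨ (b.1, b.2 + 1) ∉ D))

/-- The box `b` of `D` goes up in the outside decomposition `P`: in the strip of `P`
containing it, the next box is directly above it; an ending box goes up when no box of `D`
lies directly above it. -/
def GoesUp (D : Set Box) (P : Set (Set Box)) (b : Box) : Prop :=
  ∃ θ ∈ P, b ∈ θ ∧ ((b.1 - 1, b.2) ∈ θ ∨ (IsEndBox θ b ∧ (b.1 - 1, b.2) ∉ D))

/-- The box `b` of `D` goes right in the outside decomposition `P`: in the strip of `P`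
containing it, the next box is directly to its right; an ending box goes right when some box
of `D` lies directly above it. -/
def GoesRight (D : Set Box) (P : Set (Set Box)) (b : Box) : Prop :=
  ∃ θ ∈ P, b ∈ θ ∧ ((b.1, b.2 + 1) ∈ θ ∨ (IsEndBox θ b ∧ (b.1 - 1, b.2) ∈ D))

/-- `T` is a cutting strip of the outside decomposition `P` of `D`: a border strip whose
boxes are labeled by the contents of `D` (each content appearing once), in which the box
labeled `c` goes up or goes right according as the boxes of the diagonal of content `c`
of `D` go up or go right in `P`. -/
def IsCuttingStripOf (D : Set Box) (P : Set (Set Box)) (T : Set Box) : Prop :=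
  IsBorderStrip T ∧ boxContent '' T = boxContent '' D ∧
  ∀ b ∈ T, ∀ c ∈ D, boxContent c = boxContent b →
    (((b.1 - 1, b.2) ∈ T → GoesUp D P c) ∧ ((b.1, b.2 + 1) ∈ T → GoesRight D P c))

/-- The segment `φ[p, q]` of a strip `T`: its boxes of content between `p` and `q`. -/
def stripSegment (T : Set Box) (p q : ℤ) : Set Box :=
  {b ∈ T | p ≤ boxContent b ∧ boxContent b ≤ q}

/-- The box of content `c` of the strip `T` goes up (the next box is directly above it). -/
def StripGoesUpAt (T : Set Box) (c : ℤ) : Prop :=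
  ∃ b ∈ T, boxContent b = c ∧ (b.1 - 1, b.2) ∈ T

/-- The box of content `c` of the strip `T` goes right (the next box is directly right of it). -/
def StripGoesRightAt (T : Set Box) (c : ℤ) : Prop :=
  ∃ b ∈ T, boxContent b = c ∧ (b.1, b.2 + 1) ∈ T

/-- `T'` is obtained from the strip `T` by reversing the direction (up versus right) of the
box labeled `i`, keeping the directions of all other boxes. -/
def IsTwist (i : ℤ) (T T' : Set Box) : Prop :=
  boxContent '' T' = boxContent '' T ∧
  (∀ c : ℤ, c ≠ i → (StripGoesUpAt T c ↔ StripGoesUpAt T' c)) ∧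
  (StripGoesUpAt T i ↔ StripGoesRightAt T' i)

/-- The inversion number of an outside decomposition: the number of ordered pairs of
strips `(θ₁, θ₂)` with `p(θ₁) > p(θ₂)` and `q(θ₁) < q(θ₂)`. -/
def invOD (P : Set (Set Box)) : ℕ :=
  {θθ : Set Box × Set Box | θθ.1 ∈ P ∧ θθ.2 ∈ P ∧
    ∃ p₁ q₁ p₂ q₂ : ℤ, HasPQ θθ.1 p₁ q₁ ∧ HasPQ θθ.2 p₂ q₂ ∧ p₂ < p₁ ∧ q₁ < q₂}.ncard

/-- A semistandard Young tableau of shape `D`: entries (variable indices) weakly increase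
along rows and strictly increase down columns; entries outside `D` are normalized to `0`. -/
def IsSSYT (D : Set Box) (T : Box → ℕ) : Prop :=
  (∀ b ∈ D, (b.1, b.2 + 1) ∈ D → T b ≤ T (b.1, b.2 + 1)) ∧
  (∀ b ∈ D, (b.1 + 1, b.2) ∈ D → T b < T (b.1 + 1, b.2)) ∧
  (∀ b : Box, b ∉ D → T b = 0)

/-- The skew Schur function of a skew diagram `D`, as a formal power series in the
variables `x_n` (`n : ℕ`): the coefficient of a monomial `μ` is the number of semistandard
Young tableaux of shape `D` using each variable `n` exactly `μ n` times. -/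
def schur (D : Set Box) : MvPowerSeries ℕ ℤ :=
  fun μ => ({T : Box → ℕ | IsSSYT D T ∧ ∀ n : ℕ, μ n = {b ∈ D | T b = n}.ncard}.ncard : ℤ)

/-- `b` is the upper-right corner box of `D`: the rightmost box of the top row. -/
def IsUpperRightCorner (D : Set Box) (b : Box) : Prop :=
  b ∈ D ∧ (∀ c ∈ D, b.1 ≤ c.1) ∧ ∀ c ∈ D, c.1 = b.1 → c.2 ≤ b.2

/-- `b` is the lower-left corner box of `D`: the leftmost box of the bottom row. -/
def IsLowerLeftCorner (D : Set Box) (b : Box) : Prop :=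
  b ∈ D ∧ (∀ c ∈ D, c.1 ≤ b.1) ∧ ∀ c ∈ D, c.1 = b.1 → b.2 ≤ c.2

/-- The block (edgewise connected component) of `D` containing the box `a`. -/
def blockOf (D : Set Box) (a : Box) : Set Box :=
  {b : Box | Relation.ReflTransGen (fun x y => x ∈ D ∧ y ∈ D ∧ boxAdj x y) a b}

/-- The complete homogeneous symmetric function `h_r` (`h_0 = 1`, `h_r = 0` for `r < 0`):
the sum of all monomials of degree `r`. -/
def hSym (r : ℤ) : MvPowerSeries ℕ ℤ :=
  fun μ => if ((μ.sum fun _ e => e : ℕ) : ℤ) = r then 1 else 0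

/-- The elementary symmetric function `e_r` (`e_0 = 1`, `e_r = 0` for `r < 0`):
the sum of all squarefree monomials of degree `r`. -/
def eSym (r : ℤ) : MvPowerSeries ℕ ℤ :=
  fun μ => if (∀ n ∈ μ.support, μ n = 1) ∧ ((μ.sum fun _ e => e : ℕ) : ℤ) = r then 1 else 0

/-- The `j`-th part (`j ≥ 1`) of the conjugate partition: the number of indices `i ≥ 1`
with `λ_i ≥ j`. -/
def conjPart (lam : Partition') (j : ℕ) : ℕ := {i : ℕ | 1 ≤ i ∧ j ≤ lam.part i}.ncard

/-- The order on the supersymmetric alphabet `x_0 < x_1 < ⋯ < y_0 < y_1 < ⋯`,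
with `Sum.inl n` representing `x_n` and `Sum.inr n` representing `y_n`. -/
def entryLE : ℕ ⊕ ℕ → ℕ ⊕ ℕ → Prop
  | Sum.inl a, Sum.inl b => a ≤ b
  | Sum.inl _, Sum.inr _ => True
  | Sum.inr _, Sum.inl _ => False
  | Sum.inr a, Sum.inr b => a ≤ b

/-- A super tableau of shape `D`: rows and columns weakly increase, the `x`-symbols
strictly increase down columns, the `y`-symbols strictly increase along rows; entries
outside `D` are normalized to `Sum.inl 0`. -/
def IsSuperSSYT (D : Set Box) (T : Box → ℕ ⊕ ℕ) : Prop :=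
  (∀ b ∈ D, (b.1, b.2 + 1) ∈ D → entryLE (T b) (T (b.1, b.2 + 1))) ∧
  (∀ b ∈ D, (b.1 + 1, b.2) ∈ D → entryLE (T b) (T (b.1 + 1, b.2))) ∧
  (∀ b ∈ D, (b.1 + 1, b.2) ∈ D →
    ∀ a c : ℕ, T b = Sum.inl a → T (b.1 + 1, b.2) = Sum.inl c → a < c) ∧
  (∀ b ∈ D, (b.1, b.2 + 1) ∈ D →
    ∀ a c : ℕ, T b = Sum.inr a → T (b.1, b.2 + 1) = Sum.inr c → a < c) ∧
  (∀ b : Box, b ∉ D → T b = Sum.inl 0)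

/-- The supersymmetric skew Schur function `s_D(X, Y)`, as a formal power series in the
variables `x_n, y_n`: the coefficient of a monomial `μ` is the number of super tableaux
of shape `D` using each symbol `v` exactly `μ v` times. -/
def superSchur (D : Set Box) : MvPowerSeries (ℕ ⊕ ℕ) ℤ :=
  fun μ =>
    ({T : Box → ℕ ⊕ ℕ | IsSuperSSYT D T ∧
        ∀ v : ℕ ⊕ ℕ, μ v = {b ∈ D | T b = v}.ncard}.ncard : ℤ)

section TwistedKernels

variable {R : Type*} [CommRing R]

/-- Two kernels on `ℤ × ℤ` related by a twist at the content `i`: they agree on segments that do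
not contain both `i` and `i + 1`, and add up to the product of the two halves on the others. -/
structure IsTwistedPair (i : ℤ) (g g' : ℤ → ℤ → R) : Prop where
  eq_of_le : ∀ p q, q ≤ i → g' p q = g p q
  eq_of_lt : ∀ p q, i < p → g' p q = g p q
  eq_zero : ∀ p q, q + 1 < p → g p q = 0
  eq_one : g (i + 1) i = 1
  add : ∀ p q, p ≤ i → i < q → g p q + g' p q = g p i * g (i + 1) q

theorem IsTwistedPair.symm {i : ℤ} {g g' : ℤ → ℤ → R} (h : IsTwistedPair i g g') :
    IsTwistedPair i g' g where
  eq_of_le p q hq := (h.eq_of_le p q hq).symm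
  eq_of_lt p q hp := (h.eq_of_lt p q hp).symm
  eq_zero p q hpq := by
    rcases le_or_gt q i with hq | hq
    · rw [h.eq_of_le p q hq, h.eq_zero p q hpq]
    · rw [h.eq_of_lt p q (by omega), h.eq_zero p q hpq]
  eq_one := by rw [h.eq_of_le _ _ le_rfl, h.eq_one]
  add p q hp hq := by
    rw [add_comm, h.add p q hp hq, h.eq_of_le _ _ le_rfl, h.eq_of_lt _ _ (by omega)]

/-- The sign telling on which side of the cut between `i` and `i + 1` a content lies. -/
def cutSign (R : Type*) [CommRing R] (i c : ℤ) : R := if c ≤ i then 1 else -1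

theorem cutSign_of_le {i c : ℤ} (h : c ≤ i) : cutSign R i c = 1 := if_pos h

theorem cutSign_of_lt {i c : ℤ} (h : i < c) : cutSign R i c = -1 := if_neg (not_le.2 h)

theorem IsTwistedPair.schurComplement {i : ℤ} {g g' : ℤ → ℤ → R} (h : IsTwistedPair i g g')
    {p q : ℤ} (hp : p ≠ i + 1) (hq : q ≠ i) :
    cutSign R i p * (cutSign R i q * g' p q) = g p q - g p i * g (i + 1) q := by
  rcases le_or_gt p i with hpi | hpi <;> rcases le_or_gt q i with hqi | hqi
  · rw [cutSign_of_le hpi, cutSign_of_le hqi, h.eq_of_le p q hqi, h.eq_zero (i + 1) q (by omega)]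
    ring
  · rw [cutSign_of_le hpi, cutSign_of_lt hqi, ← h.add p q hpi hqi]
    ring
  · rw [cutSign_of_lt hpi, cutSign_of_le hqi, h.eq_of_le p q hqi, h.eq_zero p q (by omega),
      h.eq_zero p i (by omega)]
    ring
  · rw [cutSign_of_lt hpi, cutSign_of_lt hqi, h.eq_of_lt p q hpi, h.eq_zero p i (by omega)]
    ring

/-- The matrix of values of a kernel, with rows indexed by ends and columns by starts. -/
def kernelMatrix {ι : Type*} (g : ℤ → ℤ → R) (p q : ι → ℤ) : Matrix ι ι R :=
  Matrix.of fun k l => g (p l) (q k)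

variable {ι : Type*} [Fintype ι] [DecidableEq ι]

theorem det_signed_kernelMatrix (i : ℤ) (g : ℤ → ℤ → R) (p q : ι → ℤ) :
    Matrix.det (Matrix.of fun k l =>
        cutSign R i (p l) * (cutSign R i (q k) * g (p l) (q k))) =
      (∏ l, cutSign R i (p l)) * (∏ k, cutSign R i (q k)) * (kernelMatrix g p q).det := by
  have h1 := Matrix.det_mul_row (fun l => cutSign R i (p l))
    (Matrix.of fun k l => cutSign R i (q k) * g (p l) (q k))
  have h2 := Matrix.det_mul_column (fun l => cutSign R i (q l)) (kernelMatrix g p q)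
  simp only [kernelMatrix, Matrix.of_apply] at h1 h2 ⊢
  rw [h1, h2, mul_assoc]

/-- Twisting when some segment ends at `i` and none starts at `i + 1`. -/
theorem IsTwistedPair.det_of_end {i : ℤ} {g g' : ℤ → ℤ → R} (h : IsTwistedPair i g g')
    (p q : ι → ℤ) (k₀ : ι) (hk₀ : q k₀ = i) (hq : ∀ k, k ≠ k₀ → q k ≠ i)
    (hp : ∀ l, p l ≠ i + 1) :
    (kernelMatrix g p q).det =
      (∏ l, cutSign R i (p l)) * (∏ k, cutSign R i (q k)) * (kernelMatrix g' p q).det := by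
  rw [← det_signed_kernelMatrix]
  symm
  refine Matrix.det_eq_of_forall_row_eq_smul_add_const
    (fun k => if k = k₀ then 0 else -g (i + 1) (q k)) k₀ (if_pos rfl) fun k l => ?_
  simp only [kernelMatrix, Matrix.of_apply, hk₀]
  split_ifs with hk
  · subst hk
    rw [hk₀, cutSign_of_le le_rfl, h.eq_of_le _ _ le_rfl]
    rcases le_or_gt (p l) i with hpi | hpi
    · rw [cutSign_of_le hpi]; ring
    · rw [h.eq_zero _ i (by have := hp l; omega)]; ring
  · rw [h.schurComplement (hp l) (hq k hk)]
    ring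

/-- Twisting when some segment starts at `i + 1` and none ends at `i`. -/
theorem IsTwistedPair.det_of_start {i : ℤ} {g g' : ℤ → ℤ → R} (h : IsTwistedPair i g g')
    (p q : ι → ℤ) (l₀ : ι) (hl₀ : p l₀ = i + 1) (hp : ∀ l, l ≠ l₀ → p l ≠ i + 1)
    (hq : ∀ k, q k ≠ i) :
    (kernelMatrix g p q).det =
      (∏ l, cutSign R i (p l)) * (∏ k, cutSign R i (q k)) * (kernelMatrix g' p q).det := by
  rw [← det_signed_kernelMatrix, ← Matrix.det_transpose, ← Matrix.det_transpose (Matrix.of _)]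
  symm
  refine Matrix.det_eq_of_forall_row_eq_smul_add_const
    (fun l => if l = l₀ then 0 else -g (p l) i) l₀ (if_pos rfl) fun l k => ?_
  simp only [kernelMatrix, Matrix.of_apply, Matrix.transpose_apply, hl₀]
  split_ifs with hl
  · subst hl
    rw [hl₀, cutSign_of_lt (by omega), h.eq_of_lt _ _ (by omega)]
    rcases le_or_gt (q k) i with hqi | hqi
    · rw [h.eq_zero _ (q k) (by have := hq k; omega)]; ring
    · rw [cutSign_of_lt hqi]; ring
  · rw [h.schurComplement (hp l hl) (hq k)]
    ring

/-- Twisting when both a segment ending at `i` and a segment starting at `i + 1` are removed. -/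
theorem IsTwistedPair.det_bordered {i : ℤ} {g g' : ℤ → ℤ → R} (h : IsTwistedPair i g g')
    (p q : ι → ℤ) (hp : ∀ l, p l ≠ i + 1) (hq : ∀ k, q k ≠ i) :
    (kernelMatrix g (Sum.elim (fun _ : Unit => i + 1) p) (Sum.elim (fun _ : Unit => i) q)).det =
      (∏ l, cutSign R i (p l)) * (∏ k, cutSign R i (q k)) * (kernelMatrix g' p q).det := by
  rw [← det_signed_kernelMatrix]
  have hblocks :
      kernelMatrix g (Sum.elim (fun _ : Unit => i + 1) p) (Sum.elim (fun _ : Unit => i) q) =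
        Matrix.fromBlocks 1 (Matrix.of fun _ l => g (p l) i)
          (Matrix.of fun k _ => g (i + 1) (q k)) (kernelMatrix g p q) := by
    ext (k | k) (l | l) <;> simp [kernelMatrix, h.eq_one]
  rw [hblocks, Matrix.det_fromBlocks_one₁₁]
  congr 1
  ext k l
  simp only [kernelMatrix, Matrix.sub_apply, Matrix.mul_apply, Matrix.of_apply,
    Finset.univ_unique, Finset.sum_singleton, h.schurComplement (hp l) (hq k)]
  ring

variable {κ : Type*} [Fintype κ] [DecidableEq κ]

theorem det_kernelMatrix_comp_equiv (g : ℤ → ℤ → R) (p q : ι → ℤ) (e : κ ≃ ι) :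
    (kernelMatrix g (p ∘ e) (q ∘ e)).det = (kernelMatrix g p q).det :=
  Matrix.det_submatrix_equiv_self e (kernelMatrix g p q)

theorem det_kernelMatrix_comp_perm_start (g : ℤ → ℤ → R) (p q : ι → ℤ) (σ : Equiv.Perm ι) :
    (kernelMatrix g (p ∘ σ) q).det = (Equiv.Perm.sign σ : R) * (kernelMatrix g p q).det :=
  Matrix.det_permute' σ (kernelMatrix g p q)

theorem det_kernelMatrix_comp_perm_end (g : ℤ → ℤ → R) (p q : ι → ℤ) (σ : Equiv.Perm ι) :
    (kernelMatrix g p (q ∘ σ)).det = (Equiv.Perm.sign σ : R) * (kernelMatrix g p q).det :=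
  Matrix.det_permute σ (kernelMatrix g p q)

omit [Fintype κ] [DecidableEq κ] in
theorem sum_elim_snoc_eq_comp {n : ℕ} (v : Fin n → ℤ) (a : ℤ) (w : κ → ℤ) :
    Sum.elim (Fin.snoc (α := fun _ => ℤ) v a) w =
      Sum.elim (Fin.cons (α := fun _ => ℤ) a v) w ∘
        Equiv.Perm.sumCongr (finRotate (n + 1)) (1 : Equiv.Perm κ) := by
  rw [Fin.snoc_eq_cons_rotate]
  ext (k | k) <;> simp

theorem sign_sumCongr_finRotate (n : ℕ) :
    ((Equiv.Perm.sign (Equiv.Perm.sumCongr (finRotate (n + 1)) (1 : Equiv.Perm κ)) : ℤ) : R) =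
      (-1) ^ n := by
  rw [Equiv.Perm.sign_sumCongr, sign_finRotate]
  simp

theorem det_kernelMatrix_snoc_start {n : ℕ} (g : ℤ → ℤ → R) (p : Fin n → ℤ) (a : ℤ)
    (w : κ → ℤ) (q : Fin (n + 1) ⊕ κ → ℤ) :
    (kernelMatrix g (Sum.elim (Fin.snoc (α := fun _ => ℤ) p a) w) q).det =
      (-1) ^ n * (kernelMatrix g (Sum.elim (Fin.cons (α := fun _ => ℤ) a p) w) q).det := by
  rw [sum_elim_snoc_eq_comp, det_kernelMatrix_comp_perm_start, sign_sumCongr_finRotate]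

theorem det_kernelMatrix_snoc_end {n : ℕ} (g : ℤ → ℤ → R) (q : Fin n → ℤ) (a : ℤ)
    (w : κ → ℤ) (p : Fin (n + 1) ⊕ κ → ℤ) :
    (kernelMatrix g p (Sum.elim (Fin.snoc (α := fun _ => ℤ) q a) w)).det =
      (-1) ^ n * (kernelMatrix g p (Sum.elim (Fin.cons (α := fun _ => ℤ) a q) w)).det := by
  rw [sum_elim_snoc_eq_comp, det_kernelMatrix_comp_perm_end, sign_sumCongr_finRotate]

omit [DecidableEq κ] in
theorem prod_cutSign_mul_prod_cutSign {i : ℤ} {pW qW : κ → ℤ}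
    (hW : ∀ w, qW w < i ∨ i + 1 < pW w) (hpqW : ∀ w, pW w ≤ qW w) :
    (∏ w, cutSign R i (pW w)) * (∏ w, cutSign R i (qW w)) = 1 := by
  rw [← Finset.prod_mul_distrib]
  refine Finset.prod_eq_one fun w _ => ?_
  have := hpqW w
  rcases hW w with h | h
  · rw [cutSign_of_le (by omega), cutSign_of_le (by omega), one_mul]
  · rw [cutSign_of_lt (by omega), cutSign_of_lt (by omega), neg_one_mul, neg_neg]

omit [DecidableEq ι] in
theorem prod_cutSign_of_le {i : ℤ} {p : ι → ℤ} (hp : ∀ l, p l ≤ i) :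
    ∏ l, cutSign R i (p l) = 1 :=
  Finset.prod_eq_one fun l _ => cutSign_of_le (hp l)

theorem prod_cutSign_of_lt {n : ℕ} {i : ℤ} {q : Fin n → ℤ} (hq : ∀ l, i < q l) :
    ∏ l, cutSign R i (q l) = (-1) ^ n := by
  rw [Finset.prod_congr rfl fun l _ => cutSign_of_lt (hq l)]
  simp

section Strips

variable {i : ℤ} {g g' : ℤ → ℤ → R} (h : IsTwistedPair i g g') {pW qW : κ → ℤ}
  (hW : ∀ w, qW w < i ∨ i + 1 < pW w) (hpqW : ∀ w, pW w ≤ qW w)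
  {n : ℕ}

include h hW hpqW

theorem IsTwistedPair.det_shift_end {p : Fin (n + 1) → ℤ} {q : Fin n → ℤ}
    (hp : ∀ l, p l ≤ i) (hq : ∀ k, i < q k) :
    (kernelMatrix g (Sum.elim p pW)
        (Sum.elim (Fin.snoc (α := fun _ => ℤ) q i) qW)).det =
      (kernelMatrix g' (Sum.elim p pW)
        (Sum.elim (Fin.cons (α := fun _ => ℤ) i q) qW)).det := by
  rw [det_kernelMatrix_snoc_end, h.det_of_end _ _ (Sum.inl 0)]
  · simp only [Fintype.prod_sum_type, Sum.elim_inl, Sum.elim_inr, Fin.prod_univ_succ,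
      Fin.cons_zero, Fin.cons_succ]
    rw [← Fin.prod_univ_succ fun l => cutSign R i (p l), prod_cutSign_of_le hp,
      prod_cutSign_of_lt hq, cutSign_of_le le_rfl]
    have hs : ((-1 : R) ^ n) * (-1) ^ n = 1 := by rw [← mul_pow]; simp
    linear_combination
      (kernelMatrix g' (Sum.elim p pW) (Sum.elim (Fin.cons (α := fun _ => ℤ) i q) qW)).det *
        ((∏ w, cutSign R i (pW w)) * (∏ w, cutSign R i (qW w)) * hs +
          prod_cutSign_mul_prod_cutSign (R := R) hW hpqW)
  · rfl
  · rintro (k | w) hk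
    · induction k using Fin.cases with
      | zero => exact absurd rfl hk
      | succ k => exact (hq k).ne'
    · have := hpqW w
      rcases hW w with h | h <;> simp only [Sum.elim_inr] <;> omega
  · rintro (k | w)
    · have := hp k
      simp only [Sum.elim_inl]; omega
    · have := hpqW w
      rcases hW w with h | h <;> simp only [Sum.elim_inr] <;> omega

theorem IsTwistedPair.det_shift_start {p : Fin n → ℤ} {q : Fin (n + 1) → ℤ}
    (hp : ∀ l, p l ≤ i) (hq : ∀ k, i < q k) :
    (kernelMatrix g (Sum.elim (Fin.cons (α := fun _ => ℤ) (i + 1) p) pW)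
        (Sum.elim q qW)).det =
      (kernelMatrix g' (Sum.elim (Fin.snoc (α := fun _ => ℤ) p (i + 1)) pW)
        (Sum.elim q qW)).det := by
  rw [det_kernelMatrix_snoc_start, h.det_of_start _ _ (Sum.inl 0)]
  · simp only [Fintype.prod_sum_type, Sum.elim_inl, Sum.elim_inr]
    rw [Fin.prod_univ_succ fun x => cutSign R i (Fin.cons (α := fun _ => ℤ) (i + 1) p x)]
    simp only [Fin.cons_zero, Fin.cons_succ]
    rw [prod_cutSign_of_le hp, prod_cutSign_of_lt hq, cutSign_of_lt (lt_add_one i), pow_succ]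
    linear_combination
      (-1) ^ n * (kernelMatrix g' (Sum.elim (Fin.cons (α := fun _ => ℤ) (i + 1) p) pW)
        (Sum.elim q qW)).det * prod_cutSign_mul_prod_cutSign (R := R) hW hpqW
  · rfl
  · rintro (k | w) hk
    · induction k using Fin.cases with
      | zero => exact absurd rfl hk
      | succ k =>
        have := hp k
        simp only [Sum.elim_inl, Fin.cons_succ]; omega
    · have := hpqW w
      rcases hW w with h | h <;> simp only [Sum.elim_inr] <;> omega
  · rintro (k | w)
    · exact (hq k).ne'
    · have := hpqW w
      rcases hW w with h | h <;> simp only [Sum.elim_inr] <;> omega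

theorem IsTwistedPair.det_cons_cons {p q : Fin n → ℤ} (hp : ∀ l, p l ≤ i) (hq : ∀ k, i < q k) :
    (kernelMatrix g (Sum.elim (Fin.cons (α := fun _ => ℤ) (i + 1) p) pW)
        (Sum.elim (Fin.cons (α := fun _ => ℤ) i q) qW)).det =
      (-1) ^ n * (kernelMatrix g' (Sum.elim p pW) (Sum.elim q qW)).det := by
  let e : Fin (n + 1) ⊕ κ ≃ Unit ⊕ (Fin n ⊕ κ) :=
    (((finSuccEquiv n).trans ((Equiv.optionEquivSumPUnit _).trans (Equiv.sumComm _ _))).sumCongr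
      (Equiv.refl κ)).trans (Equiv.sumAssoc _ _ _)
  have he : ∀ (a : ℤ) (v : Fin n → ℤ) (w : κ → ℤ),
      Sum.elim (Fin.cons (α := fun _ => ℤ) a v) w =
        Sum.elim (fun _ : Unit => a) (Sum.elim v w) ∘ e := by
    intro a v w
    ext (k | k)
    · induction k using Fin.cases <;> simp [e]
    · simp [e]
  rw [he, he, det_kernelMatrix_comp_equiv, h.det_bordered]
  · simp only [Fintype.prod_sum_type, Sum.elim_inl, Sum.elim_inr]
    rw [prod_cutSign_of_le hp, prod_cutSign_of_lt hq]
    linear_combination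
      (-1) ^ n * (kernelMatrix g' (Sum.elim p pW) (Sum.elim q qW)).det *
        prod_cutSign_mul_prod_cutSign (R := R) hW hpqW
  · rintro (k | w)
    · have := hp k
      simp only [Sum.elim_inl]; omega
    · have := hpqW w
      rcases hW w with h | h <;> simp only [Sum.elim_inr] <;> omega
  · rintro (k | w)
    · exact (hq k).ne'
    · have := hpqW w
      rcases hW w with h | h <;> simp only [Sum.elim_inr] <;> omega

theorem IsTwistedPair.det_snoc_cons {p q : Fin n → ℤ} (hp : ∀ l, p l ≤ i) (hq : ∀ k, i < q k) :
    (kernelMatrix g (Sum.elim (Fin.snoc (α := fun _ => ℤ) p (i + 1)) pW)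
        (Sum.elim (Fin.cons (α := fun _ => ℤ) i q) qW)).det =
      (kernelMatrix g' (Sum.elim p pW) (Sum.elim q qW)).det := by
  rw [det_kernelMatrix_snoc_start, h.det_cons_cons hW hpqW hp hq, ← mul_assoc, ← mul_pow]
  simp

theorem IsTwistedPair.det_cons_snoc {p q : Fin n → ℤ} (hp : ∀ l, p l ≤ i) (hq : ∀ k, i < q k) :
    (kernelMatrix g (Sum.elim (Fin.cons (α := fun _ => ℤ) (i + 1) p) pW)
        (Sum.elim (Fin.snoc (α := fun _ => ℤ) q i) qW)).det =
      (kernelMatrix g' (Sum.elim p pW) (Sum.elim q qW)).det := by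
  rw [det_kernelMatrix_snoc_end, h.det_cons_cons hW hpqW hp hq, ← mul_assoc, ← mul_pow]
  simp

end Strips

end TwistedKernels

section SkewShapes

theorem IsSkewShape.ordConnected {D : Set Box} (hD : IsSkewShape D) : D.OrdConnected := by
  obtain ⟨lam, mu, -, rfl⟩ := hD
  refine ⟨fun a ha c hc b hb => ?_⟩
  obtain ⟨ha1, ha2, ha3⟩ := ha
  obtain ⟨hc1, hc2, hc3⟩ := hc
  obtain ⟨⟨h1, h2⟩, h3, h4⟩ := hb
  have hmu := mu.antitone (Int.toNat_le_toNat h1)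
  have hlam := lam.antitone (Int.toNat_le_toNat h3)
  refine ⟨by omega, by omega, by omega⟩

theorem IsSkewShape.finite {D : Set Box} (hD : IsSkewShape D) : D.Finite := by
  obtain ⟨lam, mu, -, rfl⟩ := hD
  obtain ⟨N, hN⟩ := lam.eventually_zero
  refine (Set.finite_Icc ((0, 0) : Box) ((N : ℤ), (lam.part 0 : ℤ))).subset ?_
  rintro ⟨r, c⟩ ⟨h1, h2, h3⟩
  simp only at h1 h2 h3
  have h0 := lam.antitone (Nat.zero_le r.toNat)
  have hrN : r ≤ N := by
    by_contra hlt
    have := hN r.toNat (by omega)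
    omega
  refine ⟨⟨?_, ?_⟩, ?_, ?_⟩ <;> simp only <;> omega

theorem IsSkewLike.ordConnected {D : Set Box} (hD : IsSkewLike D) : D.OrdConnected := by
  obtain ⟨v, hv⟩ := hD
  refine ⟨fun a ha c hc b hb => ?_⟩
  have hmem : b + v ∈ boxTranslate v D :=
    hv.ordConnected.out (Set.mem_image_of_mem _ ha) (Set.mem_image_of_mem _ hc)
      ⟨add_le_add_left hb.1 v, add_le_add_left hb.2 v⟩
  obtain ⟨b', hb', h⟩ := hmem
  rwa [← add_right_cancel h]

theorem IsSkewLike.finite {D : Set Box} (hD : IsSkewLike D) : D.Finite := by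
  obtain ⟨v, hv⟩ := hD
  exact hv.finite.of_finite_image (add_left_injective v).injOn

end SkewShapes

section BorderStrips

/-- The box directly above a given box. -/
def boxUp (b : Box) : Box := (b.1 - 1, b.2)

/-- The box directly to the right of a given box. -/
def boxRight (b : Box) : Box := (b.1, b.2 + 1)

theorem box_ext_of_content {a b : Box} (h : boxContent a = boxContent b) (h1 : a.1 = b.1) :
    a = b := by
  unfold boxContent at h
  exact Prod.ext h1 (by omega)

theorem boxAdj.cases_of_content {a b : Box} (h : boxAdj a b)
    (hc : boxContent b = boxContent a + 1) : b = boxUp a ∨ b = boxRight a := by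
  unfold boxContent at hc
  rcases h with ⟨h1, h2⟩ | ⟨h1, h2⟩
  · exact Or.inr (Prod.ext h1.symm (by simp only [boxRight]; omega))
  · exact Or.inl (Prod.ext (by simp only [boxUp]; omega) h1.symm)

theorem boxAdj.content {a b : Box} (h : boxAdj a b) :
    boxContent b = boxContent a + 1 ∨ boxContent a = boxContent b + 1 := by
  unfold boxContent
  rcases h with ⟨h1, h2⟩ | ⟨h1, h2⟩ <;> omega

theorem EdgewiseConnected.exists_adj {B : Set Box} (hB : EdgewiseConnected B) {b c : Box}
    (hb : b ∈ B) (hc : c ∈ B) {k : ℤ} (hbk : boxContent b ≤ k) (hkc : k < boxContent c) :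
    ∃ x ∈ B, ∃ y ∈ B, boxAdj x y ∧ boxContent x = k ∧ boxContent y = k + 1 := by
  have key : ∀ z, Relation.ReflTransGen (fun x y => x ∈ B ∧ y ∈ B ∧ boxAdj x y) b z →
      boxContent z ≤ k ∨
        ∃ x ∈ B, ∃ y ∈ B, boxAdj x y ∧ boxContent x = k ∧ boxContent y = k + 1 := by
    intro z hz
    induction hz with
    | refl => exact Or.inl hbk
    | @tail x y _ hxy ih =>
      rcases ih with ih | ih
      · rcases le_or_gt (boxContent y) k with hy | hy
        · exact Or.inl hy
        · rcases hxy.2.2.content with h | h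
          · exact Or.inr ⟨x, hxy.1, y, hxy.2.1, hxy.2.2, by omega, by omega⟩
          · omega
      · exact Or.inr ih
  rcases key c (hB b hb c hc) with h | h
  · omega
  · exact h

namespace IsBorderStrip

variable {B : Set Box} (hB : IsBorderStrip B)

include hB

theorem finite : B.Finite := hB.2.1.finite

theorem content_injOn : Set.InjOn boxContent B := by
  intro a ha b hb hab
  have key : ∀ a b : Box, a ∈ B → b ∈ B → boxContent a = boxContent b → ¬ a.1 < b.1 := by
    intro a b ha hb hab hlt
    unfold boxContent at hab
    have hmem : ∀ c : Box, a ≤ c → c ≤ b → c ∈ B := fun c h1 h2 =>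
      hB.2.1.ordConnected.out ha hb ⟨h1, h2⟩
    refine hB.2.2.2 a ⟨ha, hmem _ ⟨?_, ?_⟩ ⟨?_, ?_⟩, hmem _ ⟨?_, ?_⟩ ⟨?_, ?_⟩,
      hmem _ ⟨?_, ?_⟩ ⟨?_, ?_⟩⟩ <;> simp only <;> omega
  refine box_ext_of_content hab ?_
  have h1 := key a b ha hb hab
  have h2 := key b a hb ha hab.symm
  omega

theorem up_mem_or_right_mem {b c : Box} (hb : b ∈ B) (hc : c ∈ B)
    (hlt : boxContent b < boxContent c) : boxUp b ∈ B ∨ boxRight b ∈ B := by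
  obtain ⟨x, hx, y, hy, hxy, hxk, hyk⟩ := hB.2.2.1.exists_adj hb hc le_rfl hlt
  obtain rfl := hB.content_injOn hx hb hxk
  rcases hxy.cases_of_content hyk with rfl | rfl
  · exact Or.inl hy
  · exact Or.inr hy

theorem left_mem_or_below_mem {b c : Box} (hb : b ∈ B) (hc : c ∈ B)
    (hlt : boxContent c < boxContent b) : (b.1, b.2 - 1) ∈ B ∨ (b.1 + 1, b.2) ∈ B := by
  obtain ⟨x, hx, y, hy, hxy, hxk, hyk⟩ :=
    hB.2.2.1.exists_adj (k := boxContent b - 1) hc hb (by omega) (by omega)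
  obtain rfl := hB.content_injOn hy hb (by omega)
  rcases hxy.cases_of_content (by omega) with h | h
  · right
    rw [h]
    simpa [boxUp] using hx
  · left
    rw [h]
    simpa [boxRight] using hx

theorem exists_content {b c : Box} (hb : b ∈ B) (hc : c ∈ B) {k : ℤ}
    (hbk : boxContent b ≤ k) (hkc : k ≤ boxContent c) : ∃ x ∈ B, boxContent x = k := by
  rcases hkc.lt_or_eq with h | h
  · obtain ⟨x, hx, -, -, -, hxk, -⟩ := hB.2.2.1.exists_adj hb hc hbk h
    exact ⟨x, hx, hxk⟩
  · exact ⟨c, hc, h.symm⟩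

theorem content_le_of_isEndBox {b c : Box} (hb : IsEndBox B b) (hc : c ∈ B) :
    boxContent c ≤ boxContent b := by
  by_contra! hlt
  rcases hB.up_mem_or_right_mem hb.1 hc hlt with h | h
  · exact hb.2.1 h
  · exact hb.2.2 h

theorem le_content_of_isStartBox {b c : Box} (hb : IsStartBox B b) (hc : c ∈ B) :
    boxContent b ≤ boxContent c := by
  by_contra! hlt
  rcases hB.left_mem_or_below_mem hb.1 hc hlt with h | h
  · exact hb.2.1 h
  · exact hb.2.2 h

theorem isLeast_of_hasPQ {p q : ℤ} (h : HasPQ B p q) : IsLeast (boxContent '' B) p := by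
  obtain ⟨⟨b, hb, rfl⟩, -⟩ := h
  refine ⟨Set.mem_image_of_mem _ hb.1, ?_⟩
  rintro _ ⟨c, hc, rfl⟩
  exact hB.le_content_of_isStartBox hb hc

theorem isGreatest_of_hasPQ {p q : ℤ} (h : HasPQ B p q) : IsGreatest (boxContent '' B) q := by
  obtain ⟨-, b, hb, rfl⟩ := h
  refine ⟨Set.mem_image_of_mem _ hb.1, ?_⟩
  rintro _ ⟨c, hc, rfl⟩
  exact hB.content_le_of_isEndBox hb hc

end IsBorderStrip

end BorderStrips
section Inversions

open Equiv.Perm in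
theorem sign_eq_neg_one_pow_inversions {n : ℕ} (σ : Equiv.Perm (Fin n)) :
    (sign σ : ℤ) =
      (-1) ^ (Finset.univ.filter fun x : Fin n × Fin n => x.1 < x.2 ∧ σ x.2 < σ x.1).card := by
  have h : (Finset.univ.filter fun x : Fin n × Fin n => x.1 < x.2 ∧ σ x.2 < σ x.1) =
      (Finset.univ.filter fun x : Fin n × Fin n => x.1 < x.2).filter fun x => ¬ σ x.1 < σ x.2 := by
    ext ⟨k, l⟩
    simp only [Finset.mem_filter, Finset.mem_univ, true_and, not_lt]
    refine and_congr_right fun hkl => ⟨fun h => h.le, fun h => h.lt_of_ne fun h' => ?_⟩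
    exact hkl.ne' (σ.injective h')
  have hprod : (sign σ : ℤ) = ∏ x ∈ Finset.univ.filter fun x : Fin n × Fin n => x.1 < x.2,
      if σ x.1 < σ x.2 then 1 else -1 := by
    rw [sign_eq_prod_prod_Ioi, Finset.prod_filter, Fintype.prod_prod_type]
    push_cast
    refine Finset.prod_congr rfl fun k _ => ?_
    rw [← Finset.prod_filter, ← Finset.filter_lt_eq_Ioi]
    refine Finset.prod_congr rfl fun l _ => ?_
    split_ifs <;> rfl
  rw [hprod, h, Finset.prod_ite]
  simp

theorem neg_one_pow_invOD {R : Type*} [CommRing R] {m : ℕ} {θ : Fin m → Set Box}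
    (hθ : Function.Injective θ) {pθ qθ : Fin m → ℤ} (hstrip : ∀ k, IsBorderStrip (θ k))
    (hpq : ∀ k, HasPQ (θ k) (pθ k) (qθ k)) (hq : ∀ k l, k < l → qθ l < qθ k)
    {p : Fin m → ℤ} (hp : ∀ k l, k < l → p l < p k) (τ : Equiv.Perm (Fin m)) (hτ : p = pθ ∘ τ) :
    (-1 : R) ^ invOD (Set.range θ) = ((Equiv.Perm.sign τ : ℤ) : R) := by
  have hp_iff : ∀ k l, p l < p k ↔ k < l := fun k l =>
    ⟨fun h => by
      by_contra! hlk
      rcases hlk.lt_or_eq with h' | rfl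
      · exact absurd h (hp _ _ h').not_gt
      · exact lt_irrefl _ h, hp k l⟩
  have hq_iff : ∀ k l, qθ l < qθ k ↔ k < l := fun k l =>
    ⟨fun h => by
      by_contra! hlk
      rcases hlk.lt_or_eq with h' | rfl
      · exact absurd h (hq _ _ h').not_gt
      · exact lt_irrefl _ h, hq k l⟩
  have hpθ : ∀ k l, pθ k < pθ l ↔ τ⁻¹ l < τ⁻¹ k := by
    intro k l
    rw [← hp_iff, hτ]
    simp
  have hset : {θθ : Set Box × Set Box | θθ.1 ∈ Set.range θ ∧ θθ.2 ∈ Set.range θ ∧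
      ∃ p₁ q₁ p₂ q₂ : ℤ, HasPQ θθ.1 p₁ q₁ ∧ HasPQ θθ.2 p₂ q₂ ∧ p₂ < p₁ ∧ q₁ < q₂} =
      (fun x : Fin m × Fin m => (θ x.2, θ x.1)) ''
        (Finset.univ.filter fun x : Fin m × Fin m => x.1 < x.2 ∧ τ⁻¹ x.2 < τ⁻¹ x.1) := by
    ext ⟨A, B⟩
    constructor
    · rintro ⟨⟨k, rfl⟩, ⟨l, rfl⟩, p₁, q₁, p₂, q₂, h1, h2, hlt, hlt'⟩
      rw [((hstrip k).isLeast_of_hasPQ h1).unique ((hstrip k).isLeast_of_hasPQ (hpq k)),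
        ((hstrip l).isLeast_of_hasPQ h2).unique ((hstrip l).isLeast_of_hasPQ (hpq l))] at hlt
      rw [((hstrip k).isGreatest_of_hasPQ h1).unique ((hstrip k).isGreatest_of_hasPQ (hpq k)),
        ((hstrip l).isGreatest_of_hasPQ h2).unique ((hstrip l).isGreatest_of_hasPQ (hpq l))]
        at hlt'
      refine ⟨(l, k), ?_, rfl⟩
      simpa using ⟨(hq_iff _ _).1 hlt', (hpθ _ _).1 hlt⟩
    · rintro ⟨⟨l, k⟩, h, heq⟩
      obtain ⟨rfl, rfl⟩ := Prod.mk.inj heq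
      have h : l < k ∧ τ⁻¹ k < τ⁻¹ l := by simpa using h
      exact ⟨⟨k, rfl⟩, ⟨l, rfl⟩, _, _, _, _, hpq k, hpq l, (hpθ _ _).2 h.2, (hq_iff _ _).2 h.1⟩
  rw [invOD, hset, Set.ncard_image_of_injective, Set.ncard_coe_finset, ← Equiv.Perm.sign_inv,
    sign_eq_neg_one_pow_inversions]
  · push_cast
    rfl
  · rintro ⟨k, l⟩ ⟨k', l'⟩ h
    obtain ⟨h1, h2⟩ := Prod.mk.inj h
    exact Prod.ext (hθ h2) (hθ h1)

/-- The sign `(-1) ^ inv` turns the determinant with sorted starts into the determinant whose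
rows and columns are both indexed by the strips. -/
theorem neg_one_pow_invOD_mul_det {R : Type*} [CommRing R] (g : ℤ → ℤ → R) {m : ℕ}
    {θ : Fin m → Set Box} (hθ : Function.Injective θ) {pθ qθ : Fin m → ℤ}
    (hstrip : ∀ k, IsBorderStrip (θ k)) (hpq : ∀ k, HasPQ (θ k) (pθ k) (qθ k))
    (hq : ∀ k l, k < l → qθ l < qθ k) {p : Fin m → ℤ} (hp : ∀ k l, k < l → p l < p k)
    (hperm : ∃ τ : Equiv.Perm (Fin m), p = pθ ∘ τ) :
    (-1 : R) ^ invOD (Set.range θ) * (kernelMatrix g p qθ).det =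
      (kernelMatrix g pθ qθ).det := by
  obtain ⟨τ, hτ⟩ := hperm
  rw [neg_one_pow_invOD hθ hstrip hpq hq hp τ hτ, hτ, det_kernelMatrix_comp_perm_start,
    ← mul_assoc, ← Int.cast_mul, ← Units.val_mul, Int.units_mul_self]
  simp

end Inversions

section RibbonWords

/-- The reading of a semistandard tableau on a ribbon with content set `C`, where `up c` tells
whether the box of content `c + 1` lies above the box of content `c`. -/
def IsRibbonWord (up : ℤ → Prop) (C : Finset ℤ) (t : ℤ → ℕ) : Prop :=
  (∀ c ∈ C, c + 1 ∈ C → (up c → t (c + 1) < t c) ∧ (¬ up c → t c ≤ t (c + 1))) ∧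
  ∀ c, c ∉ C → t c = 0

/-- The exponent of the monomial attached to a word on `C`. -/
def wordWeight (C : Finset ℤ) (t : ℤ → ℕ) : ℕ →₀ ℕ := ∑ c ∈ C, Finsupp.single (t c) 1

/-- The generating function of ribbon words. -/
def ribbonSeries (up : ℤ → Prop) (C : Finset ℤ) : MvPowerSeries ℕ ℤ :=
  fun μ => ({t : ℤ → ℕ | IsRibbonWord up C t ∧ wordWeight C t = μ}.ncard : ℤ)

theorem wordWeight_apply (C : Finset ℤ) (t : ℤ → ℕ) (n : ℕ) :
    wordWeight C t n = (C.filter fun c => t c = n).card := by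
  rw [wordWeight, Finsupp.finsetSum_apply, Finset.card_filter]
  simp only [Finsupp.single_apply]

theorem wordWeight_congr {C : Finset ℤ} {s t : ℤ → ℕ} (h : ∀ c ∈ C, s c = t c) :
    wordWeight C s = wordWeight C t :=
  Finset.sum_congr rfl fun c hc => by rw [h c hc]

theorem mem_support_wordWeight {C : Finset ℤ} {t : ℤ → ℕ} {c : ℤ} (hc : c ∈ C) :
    t c ∈ (wordWeight C t).support := by
  rw [Finsupp.mem_support_iff, wordWeight_apply]
  exact Finset.card_ne_zero_of_mem (Finset.mem_filter.2 ⟨hc, rfl⟩)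

theorem finite_words_of_wordWeight (C : Finset ℤ) (μ : ℕ →₀ ℕ) :
    {t : ℤ → ℕ | (∀ c, c ∉ C → t c = 0) ∧ wordWeight C t = μ}.Finite := by
  refine Set.Finite.of_finite_image (f := fun t (c : C) => t c) ?_ ?_
  · refine (Set.Finite.pi' fun _ : C => μ.support.finite_toSet).subset ?_
    rintro _ ⟨t, ⟨-, rfl⟩, rfl⟩ c
    exact mem_support_wordWeight c.2
  · rintro s ⟨hs, -⟩ t ⟨ht, -⟩ hst
    ext c
    by_cases hc : c ∈ C
    · exact congrFun hst ⟨c, hc⟩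
    · rw [hs c hc, ht c hc]

theorem ribbonSeries_congr {up up' : ℤ → Prop} {C : Finset ℤ}
    (h : ∀ c ∈ C, c + 1 ∈ C → (up c ↔ up' c)) : ribbonSeries up C = ribbonSeries up' C := by
  have hw : ∀ t, IsRibbonWord up C t ↔ IsRibbonWord up' C t := fun t =>
    and_congr_left' (forall₂_congr fun c hc => forall_congr' fun hc' => by rw [h c hc hc'])
  funext μ
  simp only [ribbonSeries, hw]

theorem ribbonSeries_empty (up : ℤ → Prop) : ribbonSeries up ∅ = 1 := by
  ext μ
  rw [MvPowerSeries.coeff_one]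
  change (Set.ncard _ : ℤ) = _
  split_ifs with hμ
  · have : {t : ℤ → ℕ | IsRibbonWord up ∅ t ∧ wordWeight ∅ t = μ} = {0} := by
      ext t
      simp [IsRibbonWord, wordWeight, hμ, funext_iff]
    rw [this, Set.ncard_singleton, Nat.cast_one]
  · have : {t : ℤ → ℕ | IsRibbonWord up ∅ t ∧ wordWeight ∅ t = μ} = ∅ := by
      ext t
      simp [IsRibbonWord, wordWeight, Ne.symm hμ]
    rw [this, Set.ncard_empty, Nat.cast_zero]

section Split

variable (up : ℤ → Prop) (i : ℤ) (C : Finset ℤ)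

/-- Words on `C` satisfying all the ribbon conditions except the one between `i` and `i + 1`. -/
def IsSplitWord (t : ℤ → ℕ) : Prop :=
  (∀ c ∈ C, c + 1 ∈ C → c ≠ i → (up c → t (c + 1) < t c) ∧ (¬ up c → t c ≤ t (c + 1))) ∧
  ∀ c, c ∉ C → t c = 0

theorem ncard_splitWords_fiber (a b : ℕ →₀ ℕ) :
    {t | IsSplitWord up i C t ∧ wordWeight (C.filter (· ≤ i)) t = a ∧
        wordWeight (C.filter fun c => ¬ c ≤ i) t = b}.ncard =
      {t | IsRibbonWord up (C.filter (· ≤ i)) t ∧ wordWeight (C.filter (· ≤ i)) t = a}.ncard *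
      {t | IsRibbonWord up (C.filter fun c => ¬ c ≤ i) t ∧
        wordWeight (C.filter fun c => ¬ c ≤ i) t = b}.ncard := by
  rw [← Set.ncard_prod]
  have hadd : ∀ s t : ℤ → ℕ, (∀ c, c ∉ C.filter (· ≤ i) → s c = 0) →
      (∀ c, c ∉ C.filter (fun c => ¬ c ≤ i) → t c = 0) →
      (∀ c, c ≤ i → (s + t) c = s c) ∧ ∀ c, ¬ c ≤ i → (s + t) c = t c := by
    intro s t hs ht
    refine ⟨fun c hc => ?_, fun c hc => ?_⟩
    · simp [ht c (by simp [hc])]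
    · simp [hs c (by simp [hc])]
  symm
  refine Set.ncard_congr (fun x _ => x.1 + x.2) ?_ ?_ ?_
  · rintro ⟨s, t⟩ ⟨⟨⟨hs, hs0⟩, rfl⟩, ⟨ht, ht0⟩, rfl⟩
    replace hs0 : ∀ c, c ∉ _ → s c = 0 := hs0
    replace ht0 : ∀ c, c ∉ _ → t c = 0 := ht0
    obtain ⟨hle, hgt⟩ := hadd s t hs0 ht0
    refine ⟨⟨fun c hc hc' hci => ?_, fun c hc => ?_⟩, ?_, ?_⟩
    · rcases lt_or_gt_of_ne hci with h | h
      · simp only [hle c h.le, hle (c + 1) h]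
        exact hs c (by simp [hc, h.le]) (by simp only [Finset.mem_filter]; exact ⟨hc', h⟩)
      · simp only [hgt c h.not_ge, hgt (c + 1) (by omega)]
        exact ht c (by simp [hc, h]) (by simp only [Finset.mem_filter]; exact ⟨hc', by omega⟩)
    · simp [hs0 c (by simp [hc]), ht0 c (by simp [hc])]
    · exact wordWeight_congr fun c hc => hle c (Finset.mem_filter.1 hc).2
    · exact wordWeight_congr fun c hc => hgt c (Finset.mem_filter.1 hc).2
  · rintro ⟨s, t⟩ ⟨s', t'⟩ ⟨⟨⟨-, hs0⟩, -⟩, ⟨-, ht0⟩, -⟩ ⟨⟨⟨-, hs0'⟩, -⟩, ⟨-, ht0'⟩, -⟩ heq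
    replace hs0 : ∀ c, c ∉ _ → s c = 0 := hs0
    replace ht0 : ∀ c, c ∉ _ → t c = 0 := ht0
    replace hs0' : ∀ c, c ∉ _ → s' c = 0 := hs0'
    replace ht0' : ∀ c, c ∉ _ → t' c = 0 := ht0'
    obtain ⟨hle, hgt⟩ := hadd s t hs0 ht0
    obtain ⟨hle', hgt'⟩ := hadd s' t' hs0' ht0'
    have heq : s + t = s' + t' := heq
    refine Prod.ext (funext fun c => ?_) (funext fun c => ?_) <;> by_cases hc : c ≤ i
    · simp only [← hle c hc, ← hle' c hc, heq]
    · simp only [hs0 c (by simp [hc]), hs0' c (by simp [hc])]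
    · simp only [ht0 c (by simp [hc]), ht0' c (by simp [hc])]
    · simp only [← hgt c hc, ← hgt' c hc, heq]
  · rintro t ⟨⟨ht, ht0⟩, rfl, rfl⟩
    refine ⟨(fun c => if c ≤ i then t c else 0, fun c => if c ≤ i then 0 else t c),
      ⟨⟨⟨fun c hc hc' => ?_, fun c hc => ?_⟩, ?_⟩, ⟨fun c hc hc' => ?_, fun c hc => ?_⟩, ?_⟩, ?_⟩
    · simp only [Finset.mem_filter] at hc hc'
      simp only [hc.2, hc'.2, if_true]
      exact ht c hc.1 hc'.1 (by omega)
    · simp only [Finset.mem_filter, not_and] at hc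
      by_cases hci : c ≤ i
      · simpa [hci] using ht0 c fun h => hc h hci
      · simp [hci]
    · exact wordWeight_congr fun c hc => if_pos (Finset.mem_filter.1 hc).2
    · simp only [Finset.mem_filter] at hc hc'
      simp only [hc.2, hc'.2, if_false]
      exact ht c hc.1 hc'.1 (by omega)
    · simp only [Finset.mem_filter, not_and] at hc
      by_cases hci : c ≤ i
      · simp [hci]
      · simpa [hci] using ht0 c fun h => hc h hci
    · exact wordWeight_congr fun c hc => if_neg (Finset.mem_filter.1 hc).2
    · ext c
      by_cases hci : c ≤ i <;> simp [hci]

theorem wordWeight_filter_add (t : ℤ → ℕ) :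
    wordWeight (C.filter (· ≤ i)) t + wordWeight (C.filter fun c => ¬ c ≤ i) t =
      wordWeight C t :=
  Finset.sum_filter_add_sum_filter_not C (· ≤ i) fun c => Finsupp.single (t c) 1

theorem finite_splitWords (μ : ℕ →₀ ℕ) :
    {t | IsSplitWord up i C t ∧ wordWeight C t = μ}.Finite :=
  (finite_words_of_wordWeight C μ).subset fun _ ht => ⟨ht.1.2, ht.2⟩

theorem coeff_ribbonSeries_mul (μ : ℕ →₀ ℕ) :
    MvPowerSeries.coeff μ
        (ribbonSeries up (C.filter (· ≤ i)) * ribbonSeries up (C.filter fun c => ¬ c ≤ i)) =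
      ({t | IsSplitWord up i C t ∧ wordWeight C t = μ}.ncard : ℤ) := by
  classical
  rw [MvPowerSeries.coeff_mul, Set.ncard_eq_toFinset_card _ (finite_splitWords up i C μ),
    Finset.card_eq_sum_card_fiberwise (t := Finset.HasAntidiagonal.antidiagonal μ) (f := fun t =>
      (wordWeight (C.filter (· ≤ i)) t, wordWeight (C.filter fun c => ¬ c ≤ i) t))]
  · push_cast
    refine Finset.sum_congr rfl ?_
    rintro ⟨a, b⟩ hab
    rw [Finset.HasAntidiagonal.mem_antidiagonal] at hab
    change ((_ : ℕ) : ℤ) * ((_ : ℕ) : ℤ) = _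
    rw [← Nat.cast_mul, ← ncard_splitWords_fiber, ← Set.ncard_coe_finset]
    congr 2
    ext t
    have hadd := wordWeight_filter_add i C t
    simp only [Finset.coe_filter, Set.Finite.mem_toFinset, Set.mem_ofPred_eq, Prod.mk.injEq]
    constructor
    · rintro ⟨h, rfl, rfl⟩
      exact ⟨⟨h, by rw [← hadd, ← hab]⟩, rfl, rfl⟩
    · rintro ⟨⟨h, -⟩, h'⟩
      exact ⟨h, h'⟩
  · intro t ht
    simp only [Set.Finite.coe_toFinset, Set.mem_ofPred_eq] at ht
    exact Finset.HasAntidiagonal.mem_antidiagonal.2 ((wordWeight_filter_add i C t).trans ht.2)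

end Split

/-- Gluing two ribbons end to end, horizontally or vertically. -/
theorem ribbonSeries_add_ribbonSeries {up up' : ℤ → Prop} {i : ℤ} {C : Finset ℤ}
    (hi : i ∈ C) (hi' : i + 1 ∈ C) (hup : ¬ up i) (hup' : up' i)
    (h : ∀ c, c ≠ i → (up c ↔ up' c)) :
    ribbonSeries up C + ribbonSeries up' C =
      ribbonSeries up (C.filter (· ≤ i)) * ribbonSeries up (C.filter fun c => ¬ c ≤ i) := by
  ext μ
  rw [coeff_ribbonSeries_mul, map_add]
  change ((_ : ℕ) : ℤ) + ((_ : ℕ) : ℤ) = _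
  rw [← Nat.cast_add, ← Set.ncard_inter_add_ncard_sdiff_eq_ncard
    {t | IsSplitWord up i C t ∧ wordWeight C t = μ} {t | t i ≤ t (i + 1)}
    (finite_splitWords up i C μ)]
  congr 3
  · ext t
    constructor
    · rintro ⟨⟨ht, ht0⟩, hμ⟩
      exact ⟨⟨⟨fun c hc hc' _ => ht c hc hc', ht0⟩, hμ⟩, (ht i hi hi').2 hup⟩
    · rintro ⟨⟨⟨ht, ht0⟩, hμ⟩, hle⟩
      refine ⟨⟨fun c hc hc' => ?_, ht0⟩, hμ⟩
      by_cases hci : c = i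
      · subst hci
        exact ⟨fun hc => absurd hc hup, fun _ => hle⟩
      · exact ht c hc hc' hci
  · ext t
    constructor
    · rintro ⟨⟨ht, ht0⟩, hμ⟩
      refine ⟨⟨⟨fun c hc hc' hci => ?_, ht0⟩, hμ⟩, ((ht i hi hi').1 hup').not_ge⟩
      rw [h c hci]
      exact ht c hc hc'
    · rintro ⟨⟨⟨ht, ht0⟩, hμ⟩, hlt⟩
      refine ⟨⟨fun c hc hc' => ?_, ht0⟩, hμ⟩
      by_cases hci : c = i
      · subst hci
        exact ⟨fun _ => not_le.1 hlt, fun hc => absurd hup' hc⟩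
      · rw [← h c hci]
        exact ht c hc hc' hci

end RibbonWords

section RibbonSchur

variable {T : Set Box} (hT : IsBorderStrip T)

theorem boxContent_boxUp (b : Box) : boxContent (boxUp b) = boxContent b + 1 := by
  simp only [boxContent, boxUp]; ring

theorem boxContent_boxRight (b : Box) : boxContent (boxRight b) = boxContent b + 1 := by
  simp only [boxContent, boxRight]; ring

theorem boxUp_ne_boxRight (b : Box) : boxUp b ≠ boxRight b := fun h => by
  have := congrArg Prod.fst h
  simp only [boxUp, boxRight] at this
  omega

include hT

theorem IsBorderStrip.stripGoesUpAt_iff {b : Box} (hb : b ∈ T) :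
    StripGoesUpAt T (boxContent b) ↔ boxUp b ∈ T := by
  refine ⟨?_, fun h => ⟨b, hb, rfl, h⟩⟩
  rintro ⟨c, hc, hcb, h⟩
  obtain rfl := hT.content_injOn hc hb hcb
  exact h

theorem IsBorderStrip.stripGoesRightAt_iff {b : Box} (hb : b ∈ T) :
    StripGoesRightAt T (boxContent b) ↔ boxRight b ∈ T := by
  refine ⟨?_, fun h => ⟨b, hb, rfl, h⟩⟩
  rintro ⟨c, hc, hcb, h⟩
  obtain rfl := hT.content_injOn hc hb hcb
  exact h

theorem IsBorderStrip.not_up_and_right {b : Box} (h : boxUp b ∈ T) (h' : boxRight b ∈ T) :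
    False :=
  boxUp_ne_boxRight b
    (hT.content_injOn h h' ((boxContent_boxUp b).trans (boxContent_boxRight b).symm))

theorem IsBorderStrip.stripGoesRightAt_iff_not_up {c : ℤ} (hc : c ∈ boxContent '' T)
    (hc' : c + 1 ∈ boxContent '' T) : StripGoesRightAt T c ↔ ¬ StripGoesUpAt T c := by
  obtain ⟨b, hb, rfl⟩ := hc
  obtain ⟨b', hb', hbb'⟩ := hc'
  rw [hT.stripGoesUpAt_iff hb, hT.stripGoesRightAt_iff hb]
  refine ⟨fun h h' => hT.not_up_and_right h' h, fun h => ?_⟩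
  exact (hT.up_mem_or_right_mem hb hb' (by omega)).resolve_left h

theorem IsBorderStrip.schur_stripSegment (p q : ℤ) (C : Finset ℤ)
    (hC : (C : Set ℤ) = boxContent '' stripSegment T p q) :
    schur (stripSegment T p q) = ribbonSeries (StripGoesUpAt T) C := by
  classical
  set S := stripSegment T p q
  have hST : S ⊆ T := fun b hb => hb.1
  have hinj : Set.InjOn boxContent S := hT.content_injOn.mono hST
  have hmem : ∀ c, c ∈ C ↔ ∃ b ∈ S, boxContent b = c := fun c => by
    rw [← Finset.mem_coe, hC]; rfl
  have hweight : ∀ (t : Box → ℕ) (w : ℤ → ℕ), (∀ b ∈ S, t b = w (boxContent b)) →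
      ∀ μ : ℕ →₀ ℕ, (∀ n, μ n = {b ∈ S | t b = n}.ncard) ↔ wordWeight C w = μ := by
    intro t w htw μ
    rw [Finsupp.ext_iff]
    refine forall_congr' fun n => ?_
    have : ((C.filter fun c => w c = n : Finset ℤ) : Set ℤ) =
        boxContent '' {b ∈ S | t b = n} := by
      ext c
      simp only [Finset.coe_filter, Set.mem_ofPred_eq, hmem]
      constructor
      · rintro ⟨⟨b, hb, rfl⟩, h⟩
        exact ⟨b, ⟨hb, (htw b hb).trans h⟩, rfl⟩
      · rintro ⟨b, ⟨hb, h⟩, rfl⟩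
        exact ⟨⟨b, hb, rfl⟩, (htw b hb).symm.trans h⟩
    rw [wordWeight_apply, ← Set.ncard_coe_finset, this,
      (hinj.mono fun b hb => hb.1).ncard_image]
    exact eq_comm
  funext μ
  simp only [schur, ribbonSeries]
  congr 1
  symm
  refine Set.ncard_congr (fun w _ b => if b ∈ S then w (boxContent b) else 0) ?_ ?_ ?_
  · rintro w ⟨⟨hw, hw0⟩, hμ⟩
    refine ⟨⟨fun b hb hb' => ?_, fun b hb hb' => ?_, fun b hb => if_neg hb⟩, ?_⟩
    · simp only [if_pos hb, if_pos hb']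
      have hc : boxContent (b.1, b.2 + 1) = boxContent b + 1 := boxContent_boxRight b
      rw [hc]
      refine (hw _ ((hmem _).2 ⟨b, hb, rfl⟩) ((hmem _).2 ⟨_, hb', hc⟩)).2 fun hup => ?_
      exact hT.not_up_and_right ((hT.stripGoesUpAt_iff (hST hb)).1 hup) (hST hb')
    · simp only [if_pos hb, if_pos hb']
      have hup : boxUp (b.1 + 1, b.2) = b := Prod.ext (add_sub_cancel_right _ _) rfl
      have hc := boxContent_boxUp (b.1 + 1, b.2)
      rw [hup] at hc
      rw [hc]
      refine (hw _ ((hmem _).2 ⟨_, hb', rfl⟩) ((hmem _).2 ⟨b, hb, hc⟩)).1 ?_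
      rw [hT.stripGoesUpAt_iff (hST hb'), hup]
      exact hST hb
    · exact (hweight _ w (fun b hb => if_pos hb) μ).2 hμ
  · rintro w w' ⟨⟨-, hw0⟩, -⟩ ⟨⟨-, hw0'⟩, -⟩ h
    ext c
    by_cases hc : c ∈ C
    · obtain ⟨b, hb, rfl⟩ := (hmem c).1 hc
      simpa [hb] using congrFun h b
    · rw [hw0 c hc, hw0' c hc]
  · rintro t ⟨⟨hrow, hcol, h0⟩, hμ⟩
    let w : ℤ → ℕ := fun c => if h : ∃ b ∈ S, boxContent b = c then t h.choose else 0
    have hw : ∀ b ∈ S, t b = w (boxContent b) := by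
      intro b hb
      have hex : ∃ b' ∈ S, boxContent b' = boxContent b := ⟨b, hb, rfl⟩
      simp only [w, dif_pos hex]
      rw [hinj hex.choose_spec.1 hb hex.choose_spec.2]
    refine ⟨w, ⟨⟨fun c hc hc' => ?_, fun c hc => ?_⟩, (hweight t w hw μ).1 hμ⟩, ?_⟩
    · obtain ⟨b, hb, rfl⟩ := (hmem c).1 hc
      obtain ⟨b', hb', hbb'⟩ := (hmem _).1 hc'
      rw [← hbb', ← hw b hb, ← hw b' hb', hT.stripGoesUpAt_iff (hST hb)]
      constructor
      · intro hup
        obtain rfl := hT.content_injOn (hST hb') hup (by rw [hbb', boxContent_boxUp])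
        have hbelow : ((boxUp b).1 + 1, (boxUp b).2) = b := Prod.ext (sub_add_cancel _ _) rfl
        have := hcol _ hb'
        rw [hbelow] at this
        exact this hb
      · intro hup
        have hright := (hT.up_mem_or_right_mem (hST hb) (hST hb') (by omega)).resolve_left hup
        obtain rfl := hT.content_injOn (hST hb') hright (by rw [hbb', boxContent_boxRight])
        exact hrow b hb hb'
    · exact dif_neg fun h => hc ((hmem c).2 h)
    · ext b
      by_cases hb : b ∈ S
      · simp [hb, hw b hb]
      · simp [hb, h0 b hb]

omit hT in
theorem exists_finset_coe_eq_content_stripSegment (hfin : T.Finite) :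
    ∃ C : Finset ℤ, (C : Set ℤ) = boxContent '' T ∧
      ∀ p q : ℤ, ((C.filter fun c => p ≤ c ∧ c ≤ q : Finset ℤ) : Set ℤ) =
        boxContent '' stripSegment T p q := by
  refine ⟨(hfin.image boxContent).toFinset, by simp, fun p q => ?_⟩
  ext c
  simp only [Finset.coe_filter, Set.Finite.mem_toFinset, Set.mem_ofPred_eq, stripSegment]
  constructor
  · rintro ⟨⟨b, hb, rfl⟩, h⟩
    exact ⟨b, ⟨hb, h⟩, rfl⟩
  · rintro ⟨b, ⟨hb, h⟩, rfl⟩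
    exact ⟨⟨b, hb, rfl⟩, h⟩

/-- The kernel `(p, q) ↦ s_{T[p, q]}` of the Hamel–Goulden determinant. -/
def stripKernel (T : Set Box) (p q : ℤ) : MvPowerSeries ℕ ℤ :=
  if p ≤ q + 1 then schur (stripSegment T p q) else 0

omit hT in
theorem isTwistedPair_stripKernel {T T' : Set Box} (hT : IsBorderStrip T) (hT' : IsBorderStrip T')
    (hcont : boxContent '' T' = boxContent '' T) {i : ℤ} (hi : i ∈ boxContent '' T)
    (hi' : i + 1 ∈ boxContent '' T) (hup : ¬ StripGoesUpAt T i) (hup' : StripGoesUpAt T' i)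
    (h : ∀ c, c ≠ i → (StripGoesUpAt T c ↔ StripGoesUpAt T' c)) :
    IsTwistedPair i (stripKernel T) (stripKernel T') := by
  obtain ⟨C, hCT, hC⟩ := exists_finset_coe_eq_content_stripSegment hT.finite
  obtain ⟨C', hCT', hC'⟩ := exists_finset_coe_eq_content_stripSegment hT'.finite
  obtain rfl : C' = C := Finset.coe_injective (by rw [hCT', hCT, hcont])
  have hk := fun p q => hT.schur_stripSegment p q _ (hC p q)
  have hk' := fun p q => hT'.schur_stripSegment p q _ (hC' p q)
  rw [← hCT] at hi hi'
  have hcongr : ∀ p q, ¬ (p ≤ i ∧ i < q) → stripKernel T' p q = stripKernel T p q := by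
    intro p q hpq
    simp only [stripKernel, hk, hk']
    rw [ribbonSeries_congr fun c hc hc' => h c ?_]
    rintro rfl
    simp only [Finset.mem_filter] at hc hc'
    omega
  refine ⟨fun p q hq => hcongr p q (by omega), fun p q hp => hcongr p q (by omega),
    fun p q hpq => if_neg (by omega), ?_, fun p q hp hq => ?_⟩
  · rw [stripKernel, if_pos le_rfl, hk, Finset.filter_false_of_mem fun c _ => by omega,
      ribbonSeries_empty]
  · rw [stripKernel, stripKernel, stripKernel, stripKernel, if_pos (by omega), if_pos (by omega),
      if_pos (by omega), if_pos (by omega), hk, hk, hk, hk', ribbonSeries_add_ribbonSeries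
        (i := i) (by simp only [Finset.mem_filter]; exact ⟨hi, by omega⟩)
        (by simp only [Finset.mem_filter]; exact ⟨hi', by omega⟩) hup hup' h,
      Finset.filter_filter, Finset.filter_filter]
    congr 2 <;> refine Finset.filter_congr fun c _ => ?_ <;> omega

end RibbonSchur

section DirectedDecompositions

open Classical in
/-- The box following `b` along a strip whose directions are prescribed by `up`. -/
def boxNext (up : ℤ → Prop) (b : Box) : Box := if up (boxContent b) then boxUp b else boxRight b

/-- A decomposition of `D` into border strips whose directions only depend on the content. -/
structure IsDirectedDecomposition (D : Set Box) (P : Set (Set Box)) (up : ℤ → Prop) : Prop where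
  isBorderStrip : ∀ S ∈ P, IsBorderStrip S
  subset : ∀ S ∈ P, S ⊆ D
  exists_mem : ∀ b ∈ D, ∃ S ∈ P, b ∈ S
  eq_of_mem : ∀ S ∈ P, ∀ S' ∈ P, ∀ b ∈ S, b ∈ S' → S = S'
  mem_iff : ∀ S ∈ P, ∀ b ∈ S, ∀ b' ∈ D, boxContent b' = boxContent b + 1 →
    (b' ∈ S ↔ b' = boxNext up b)

theorem IsOutsideDecomposition.isDirectedDecomposition {D : Set Box} {P : Set (Set Box)}
    {T : Set Box} (hP : IsOutsideDecomposition D P) (hT : IsCuttingStripOf D P T) :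
    IsDirectedDecomposition D P (StripGoesUpAt T) := by
  obtain ⟨hstrip, hpart, -, hend⟩ := hP
  obtain ⟨hTs, hTc, hdir⟩ := hT
  have huniq : ∀ S ∈ P, ∀ S' ∈ P, ∀ b ∈ S, b ∈ S' → S = S' := by
    intro S hS S' hS' b hb hb'
    exact (hpart b ((hstrip S hS).2 hb)).unique ⟨hS, hb⟩ ⟨hS', hb'⟩
  refine ⟨fun S hS => (hstrip S hS).1, fun S hS => (hstrip S hS).2,
    fun b hb => (hpart b hb).exists, huniq, fun S hS b hb b' hb' hc => ?_⟩
  have hB := (hstrip S hS).1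
  have hSD := (hstrip S hS).2
  have hnotend : IsEndBox S b → b' ∉ S := fun he hmem => by
    have := hB.content_le_of_isEndBox he hmem
    omega
  obtain ⟨t, ht, htc⟩ : boxContent b ∈ boxContent '' T := hTc ▸ Set.mem_image_of_mem _ (hSD hb)
  obtain ⟨t', ht', htc'⟩ : boxContent b' ∈ boxContent '' T := hTc ▸ Set.mem_image_of_mem _ hb'
  have hdir := hdir t ht b (hSD hb) htc.symm
  by_cases hup : StripGoesUpAt T (boxContent b)
  · rw [boxNext, if_pos hup]
    rw [← htc, hTs.stripGoesUpAt_iff ht] at hup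
    obtain ⟨S', hS', hbS', h⟩ := hdir.1 hup
    obtain rfl := huniq S hS S' hS' b hb hbS'
    rcases h with h | ⟨he, hD⟩
    · refine ⟨fun hmem => hB.content_injOn hmem h (hc.trans (boxContent_boxUp b).symm), ?_⟩
      rintro rfl
      exact h
    · refine ⟨fun hmem => absurd hmem (hnotend he), ?_⟩
      rintro rfl
      exact absurd hb' hD
  · rw [boxNext, if_neg hup]
    rw [← htc, hTs.stripGoesUpAt_iff ht] at hup
    have hright := (hTs.up_mem_or_right_mem ht ht' (by omega)).resolve_left hup
    obtain ⟨S', hS', hbS', h⟩ := hdir.2 hright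
    obtain rfl := huniq S hS S' hS' b hb hbS'
    rcases h with h | ⟨he, hD⟩
    · refine ⟨fun hmem => hB.content_injOn hmem h (hc.trans (boxContent_boxRight b).symm), ?_⟩
      rintro rfl
      exact h
    · refine ⟨fun hmem => absurd hmem (hnotend he), ?_⟩
      rintro rfl
      exact ((hend S hS b he).resolve_left fun h => h hD).elim hb'

/-- The content of the starting box of a strip. -/
def stripStart (S : Set Box) : ℤ := sInf (Set.image boxContent S)

/-- The content of the ending box of a strip. -/
def stripEnd (S : Set Box) : ℤ := sSup (Set.image boxContent S)

theorem IsBorderStrip.isLeast_stripStart {S : Set Box} (hS : IsBorderStrip S) :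
    IsLeast (boxContent '' S) (stripStart S) :=
  have hfin := hS.finite.image boxContent
  ⟨(hS.1.image boxContent).csInf_mem hfin, fun _ hc => csInf_le hfin.bddBelow hc⟩

theorem IsBorderStrip.isGreatest_stripEnd {S : Set Box} (hS : IsBorderStrip S) :
    IsGreatest (boxContent '' S) (stripEnd S) :=
  have hfin := hS.finite.image boxContent
  ⟨(hS.1.image boxContent).csSup_mem hfin, fun _ hc => le_csSup hfin.bddAbove hc⟩

namespace IsDirectedDecomposition

section Transfer

variable {D : Set Box} {P P' : Set (Set Box)} {up up' : ℤ → Prop}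
  (hP : IsDirectedDecomposition D P up) (hP' : IsDirectedDecomposition D P' up')
  {S S' : Set Box} (hS : S ∈ P) (hS' : S' ∈ P')

include hP hP' hS

theorem mem_of_content_le (hS' : S' ∈ P') {b c : Box} (hbS : b ∈ S) (hbS' : b ∈ S') (hc : c ∈ S)
    (hle : boxContent b ≤ boxContent c)
    (hup : ∀ k, boxContent b ≤ k → k < boxContent c → (up k ↔ up' k)) : c ∈ S' := by
  have hB := hP.isBorderStrip S hS
  obtain ⟨d, hd⟩ := Int.eq_ofNat_of_zero_le (sub_nonneg.2 hle)
  induction d generalizing c with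
  | zero =>
    rwa [hB.content_injOn hc hbS (by omega)]
  | succ d ih =>
    obtain ⟨x, hx, hxc⟩ := hB.exists_content (k := boxContent c - 1) hbS hc (by omega) (by omega)
    have hxS' := ih hx (by omega) (fun k h1 h2 => hup k h1 (by omega)) (by omega)
    have hcD := hP.subset S hS hc
    have hcx := (hP.mem_iff S hS x hx c hcD (by omega)).1 hc
    rw [hP'.mem_iff S' hS' x hxS' c hcD (by omega), hcx, boxNext, boxNext,
      hup (boxContent x) (by omega) (by omega)]

include hS'

theorem mem_of_agree {b c : Box} (hbS : b ∈ S) (hbS' : b ∈ S') (hc : c ∈ S)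
    (hup : ∀ k, min (boxContent b) (boxContent c) ≤ k → k < max (boxContent b) (boxContent c) →
      (up k ↔ up' k)) : c ∈ S' := by
  rcases le_total (boxContent b) (boxContent c) with h | h
  · exact hP.mem_of_content_le hP' hS hS' hbS hbS' hc h fun k h1 h2 =>
      hup k (by omega) (by omega)
  · obtain ⟨S'', hS'', hcS''⟩ := hP'.exists_mem c (hP.subset S hS hc)
    have := hP.mem_of_content_le hP' hS hS'' hc hcS'' hbS h fun k h1 h2 =>
      hup k (by omega) (by omega)
    rwa [hP'.eq_of_mem S' hS' S'' hS'' b hbS' this]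

theorem stripStart_le {b : Box} (hbS : b ∈ S) (hbS' : b ∈ S')
    (hup : ∀ k, k < boxContent b → (up k ↔ up' k)) : stripStart S' ≤ stripStart S := by
  obtain ⟨⟨c, hc, hcS⟩, hlow⟩ := (hP.isBorderStrip S hS).isLeast_stripStart
  have hcb := hlow (Set.mem_image_of_mem _ hbS)
  rw [← hcS]
  refine (hP'.isBorderStrip S' hS').isLeast_stripStart.2 (Set.mem_image_of_mem _ ?_)
  exact hP.mem_of_agree hP' hS hS' hbS hbS' hc fun k _ h => hup k (by omega)

theorem le_stripEnd {b : Box} (hbS : b ∈ S) (hbS' : b ∈ S')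
    (hup : ∀ k, boxContent b ≤ k → (up k ↔ up' k)) : stripEnd S ≤ stripEnd S' := by
  obtain ⟨⟨c, hc, hcS⟩, hlow⟩ := (hP.isBorderStrip S hS).isGreatest_stripEnd
  have hcb := hlow (Set.mem_image_of_mem _ hbS)
  rw [← hcS]
  refine (hP'.isBorderStrip S' hS').isGreatest_stripEnd.2 (Set.mem_image_of_mem _ ?_)
  exact hP.mem_of_agree hP' hS hS' hbS hbS' hc fun k h _ => hup k (by omega)

theorem stripStart_eq {b : Box} (hbS : b ∈ S) (hbS' : b ∈ S')
    (hup : ∀ k, k < boxContent b → (up k ↔ up' k)) : stripStart S = stripStart S' :=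
  le_antisymm (hP'.stripStart_le hP hS' hS hbS' hbS fun k hk => (hup k hk).symm)
    (hP.stripStart_le hP' hS hS' hbS hbS' hup)

theorem stripEnd_eq {b : Box} (hbS : b ∈ S) (hbS' : b ∈ S')
    (hup : ∀ k, boxContent b ≤ k → (up k ↔ up' k)) : stripEnd S = stripEnd S' :=
  le_antisymm (hP.le_stripEnd hP' hS hS' hbS hbS' hup)
    (hP'.le_stripEnd hP hS' hS hbS' hbS fun k hk => (hup k hk).symm)

end Transfer

end IsDirectedDecomposition

/-- The strips of `P` that meet neither the diagonal of content `i` nor that of content `i + 1`. -/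
def stripsAvoiding (P : Set (Set Box)) (i : ℤ) : Set (Set Box) :=
  {S ∈ P | ∀ b ∈ S, boxContent b ≠ i ∧ boxContent b ≠ i + 1}

/-- The union of the strips of `P` containing `b`. -/
def stripThrough (P : Set (Set Box)) (b : Box) : Set Box := {c | ∃ S ∈ P, b ∈ S ∧ c ∈ S}

/-- The box of content `c` in row `r`. -/
def diagBox (c r : ℤ) : Box := (r, r + c)

theorem boxContent_diagBox (c r : ℤ) : boxContent (diagBox c r) = c := by
  simp [boxContent, diagBox]

theorem eq_diagBox {b : Box} {c : ℤ} (h : boxContent b = c) : b = diagBox c b.1 :=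
  box_ext_of_content (h.trans (boxContent_diagBox c _).symm) rfl

theorem diagBox_injective (c : ℤ) : Function.Injective (diagBox c) := fun _ _ h =>
  congrArg Prod.fst h

theorem boxNext_diagBox_of_up {up : ℤ → Prop} {i : ℤ} (h : up i) (r : ℤ) :
    boxNext up (diagBox i r) = diagBox (i + 1) (r - 1) := by
  rw [boxNext, boxContent_diagBox, if_pos h]
  exact Prod.ext rfl (by simp only [boxUp, diagBox]; ring)

theorem boxNext_diagBox_of_not_up {up : ℤ → Prop} {i : ℤ} (h : ¬ up i) (r : ℤ) :
    boxNext up (diagBox i r) = diagBox (i + 1) (r - 0) := by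
  rw [boxNext, boxContent_diagBox, if_neg h]
  exact Prod.ext (sub_zero r).symm (by simp only [boxRight, diagBox]; ring)

open Classical in
/-- The starting content of the strip through the box of content `i` in row `r`, and `i + 1` when
there is no such box in `D`. -/
def startAt (D : Set Box) (P : Set (Set Box)) (i r : ℤ) : ℤ :=
  if diagBox i r ∈ D then stripStart (stripThrough P (diagBox i r)) else i + 1

open Classical in
/-- The ending content of the strip through the box of content `i + 1` in row `r`, and `i` when
there is no such box in `D`. -/
def endAt (D : Set Box) (P : Set (Set Box)) (i r : ℤ) : ℤ :=
  if diagBox (i + 1) r ∈ D then stripEnd (stripThrough P (diagBox (i + 1) r)) else i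

namespace IsDirectedDecomposition

variable {D : Set Box} {P : Set (Set Box)} {up : ℤ → Prop} (hP : IsDirectedDecomposition D P up)

include hP

theorem stripThrough_eq {S : Set Box} (hS : S ∈ P) {b : Box} (hb : b ∈ S) :
    stripThrough P b = S := by
  ext c
  refine ⟨?_, fun hc => ⟨S, hS, hb, hc⟩⟩
  rintro ⟨S', hS', hb', hc⟩
  rwa [hP.eq_of_mem S hS S' hS' b hb hb']

theorem stripThrough_mem {b : Box} (hb : b ∈ D) : stripThrough P b ∈ P ∧ b ∈ stripThrough P b := by
  obtain ⟨S, hS, hbS⟩ := hP.exists_mem b hb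
  rw [hP.stripThrough_eq hS hbS]
  exact ⟨hS, hbS⟩

theorem startAt_le {i r : ℤ} (h : diagBox i r ∈ D) : startAt D P i r ≤ i := by
  obtain ⟨h1, h2⟩ := hP.stripThrough_mem h
  rw [startAt, if_pos h]
  refine (hP.isBorderStrip _ h1).isLeast_stripStart.2 ⟨_, h2, boxContent_diagBox _ _⟩

theorem lt_endAt {i r : ℤ} (h : diagBox (i + 1) r ∈ D) : i < endAt D P i r := by
  obtain ⟨h1, h2⟩ := hP.stripThrough_mem h
  rw [endAt, if_pos h]
  exact Int.lt_of_add_one_le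
    ((hP.isBorderStrip _ h1).isGreatest_stripEnd.2 ⟨_, h2, boxContent_diagBox _ _⟩)

theorem stripsAvoiding_spec {i : ℤ} {S : Set Box} (hS : S ∈ stripsAvoiding P i) :
    stripEnd S < i ∨ i + 1 < stripStart S := by
  have hB := hP.isBorderStrip S hS.1
  obtain ⟨⟨b, hb, hbS⟩, -⟩ := hB.isLeast_stripStart
  obtain ⟨⟨c, hc, hcS⟩, -⟩ := hB.isGreatest_stripEnd
  by_contra! h
  have h1 := hS.2 b hb
  have h2 := hS.2 c hc
  obtain ⟨x, hx, hxi⟩ := hB.exists_content (k := i) hb hc (by omega) (by omega)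
  exact (hS.2 x hx).1 hxi

theorem stripStart_le_stripEnd {S : Set Box} (hS : S ∈ P) : stripStart S ≤ stripEnd S :=
  have hB := hP.isBorderStrip S hS
  hB.isGreatest_stripEnd.2 hB.isLeast_stripStart.1

section Twist

variable {P' : Set (Set Box)} {up' : ℤ → Prop} (hP' : IsDirectedDecomposition D P' up') {i : ℤ}
  (hup : ∀ c, c ≠ i → (up c ↔ up' c))

include hP' hup

theorem startAt_eq (r : ℤ) : startAt D P i r = startAt D P' i r := by
  unfold startAt
  split_ifs with h
  · obtain ⟨h1, h2⟩ := hP.stripThrough_mem h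
    obtain ⟨h1', h2'⟩ := hP'.stripThrough_mem h
    refine hP.stripStart_eq hP' h1 h1' h2 h2' fun k hk => hup k ?_
    rw [boxContent_diagBox] at hk
    exact hk.ne
  · rfl

theorem endAt_eq (r : ℤ) : endAt D P i r = endAt D P' i r := by
  unfold endAt
  split_ifs with h
  · obtain ⟨h1, h2⟩ := hP.stripThrough_mem h
    obtain ⟨h1', h2'⟩ := hP'.stripThrough_mem h
    refine hP.stripEnd_eq hP' h1 h1' h2 h2' fun k hk => hup k ?_
    rw [boxContent_diagBox] at hk
    omega
  · rfl

theorem stripsAvoiding_subset : stripsAvoiding P i ⊆ stripsAvoiding P' i := by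
  rintro S ⟨hS, hSi⟩
  have hB := hP.isBorderStrip S hS
  obtain ⟨b, hb⟩ := hB.1
  obtain ⟨S', hS', hbS'⟩ := hP'.exists_mem b (hP.subset S hS hb)
  have hB' := hP'.isBorderStrip S' hS'
  have hbi := hSi b hb
  suffices S = S' from ⟨this ▸ hS', hSi⟩
  apply Set.Subset.antisymm
  · intro c hc
    refine hP.mem_of_agree hP' hS hS' hb hbS' hc fun k h1 h2 => hup k ?_
    rintro rfl
    rcases le_total (boxContent b) (boxContent c) with hbc | hbc
    · obtain ⟨x, hx, hxi⟩ := hB.exists_content (k := k) hb hc (by omega) (by omega)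
      exact (hSi x hx).1 hxi
    · obtain ⟨x, hx, hxi⟩ := hB.exists_content (k := k) hc hb (by omega) (by omega)
      exact (hSi x hx).1 hxi
  · intro c hc
    refine hP'.mem_of_agree hP hS' hS hbS' hb hc fun k h1 h2 => (hup k ?_).symm
    rintro rfl
    rcases le_total (boxContent b) (boxContent c) with hbc | hbc
    · obtain ⟨x, hx, hxi⟩ := hB'.exists_content (k := k) hbS' hc (by omega) (by omega)
      refine (hSi x ?_).1 hxi
      exact hP'.mem_of_agree hP hS' hS hbS' hb hx fun l h1 h2 => (hup l (by omega)).symm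
    · obtain ⟨x, hx, hxi⟩ := hB'.exists_content (k := k + 1) hc hbS' (by omega) (by omega)
      refine (hSi x ?_).2 hxi
      exact hP'.mem_of_agree hP hS' hS hbS' hb hx fun l h1 h2 => (hup l (by omega)).symm

theorem stripsAvoiding_eq : stripsAvoiding P i = stripsAvoiding P' i :=
  (hP.stripsAvoiding_subset hP' hup).antisymm
    (hP'.stripsAvoiding_subset hP fun c hc => (hup c hc).symm)

end Twist

section Indexing

variable {i s : ℤ} (hs : ∀ r, boxNext up (diagBox i r) = diagBox (i + 1) (r - s))

include hs

theorem diagBox_mem_iff {S : Set Box} (hS : S ∈ P) {r r' : ℤ} (hr : diagBox i r ∈ S)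
    (hr' : diagBox (i + 1) (r' - s) ∈ D) : diagBox (i + 1) (r' - s) ∈ S ↔ r' = r := by
  rw [hP.mem_iff S hS _ hr _ hr' (by simp only [boxContent_diagBox]), hs,
    (diagBox_injective _).eq_iff]
  omega

/-- A box of the diagonals `i` and `i + 1` on the strip that crosses them, starts or ends there,
in the row of its box of content `i`. -/
theorem exists_strip_of_row {r : ℤ} (hr : diagBox i r ∈ D ∨ diagBox (i + 1) (r - s) ∈ D) :
    ∃ S ∈ P, (diagBox i r ∈ D → diagBox i r ∈ S) ∧
      (diagBox (i + 1) (r - s) ∈ D → diagBox (i + 1) (r - s) ∈ S) ∧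
      stripStart S = startAt D P i r ∧ stripEnd S = endAt D P i (r - s) := by
  obtain ⟨S, hS, hx, hy⟩ : ∃ S ∈ P, (diagBox i r ∈ D → diagBox i r ∈ S) ∧
      (diagBox (i + 1) (r - s) ∈ D → diagBox (i + 1) (r - s) ∈ S) := by
    by_cases hx : diagBox i r ∈ D
    · obtain ⟨S, hS, hxS⟩ := hP.exists_mem _ hx
      exact ⟨S, hS, fun _ => hxS, fun hy => (hP.diagBox_mem_iff hs hS hxS hy).2 rfl⟩
    · obtain ⟨S, hS, hyS⟩ := hP.exists_mem _ (hr.resolve_left hx)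
      exact ⟨S, hS, fun h => absurd h hx, fun _ => hyS⟩
  have hB := hP.isBorderStrip S hS
  refine ⟨S, hS, hx, hy, ?_, ?_⟩
  · unfold startAt
    split_ifs with h
    · rw [hP.stripThrough_eq hS (hx h)]
    · have hyD := hr.resolve_left h
      refine hB.isLeast_stripStart.unique ⟨⟨_, hy hyD, boxContent_diagBox _ _⟩, ?_⟩
      rintro _ ⟨z, hz, rfl⟩
      by_contra! hlt
      obtain ⟨x, hxS, hxi⟩ := hB.exists_content (k := i) hz (hy hyD) (by omega)
        (by rw [boxContent_diagBox]; omega)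
      rw [eq_diagBox hxi] at hxS
      rw [hP.diagBox_mem_iff hs hS hxS hyD] at hy
      rw [← hy hyD] at hxS
      exact h (hP.subset S hS hxS)
  · unfold endAt
    split_ifs with h
    · rw [hP.stripThrough_eq hS (hy h)]
    · have hxD := hr.resolve_right h
      refine hB.isGreatest_stripEnd.unique ⟨⟨_, hx hxD, boxContent_diagBox _ _⟩, ?_⟩
      rintro _ ⟨z, hz, rfl⟩
      by_contra! hlt
      obtain ⟨y, hyS, hyi⟩ := hB.exists_content (k := i + 1) (hx hxD) hz
        (by rw [boxContent_diagBox]; omega) (by omega)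
      obtain ⟨r', hr'⟩ : ∃ r', y = diagBox (i + 1) (r' - s) :=
        ⟨y.1 + s, by rw [add_sub_cancel_right]; exact eq_diagBox hyi⟩
      subst hr'
      have hyD := hP.subset S hS hyS
      rw [hP.diagBox_mem_iff hs hS (hx hxD) hyD] at hyS
      exact h (hyS ▸ hyD)

theorem det_kernelMatrix_strips {R : Type*} [CommRing R] (g : ℤ → ℤ → R) {lo : ℤ} {n : ℕ}
    (hI : ∀ r, (diagBox i r ∈ D ∨ diagBox (i + 1) (r - s) ∈ D) ↔ lo ≤ r ∧ r < lo + n)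
    {W : Set (Set Box)} [Fintype W] [DecidableEq W] (hW : stripsAvoiding P i = W)
    {m : ℕ} {θ : Fin m → Set Box} (hθ : Function.Injective θ) (hθP : Set.range θ = P) :
    (kernelMatrix g (stripStart ∘ θ) (stripEnd ∘ θ)).det =
      (kernelMatrix g
        (Sum.elim (fun j : Fin n => startAt D P i (lo + j)) fun w : W => stripStart w)
        (Sum.elim (fun j : Fin n => endAt D P i (lo - s + j)) fun w : W => stripEnd w)).det := by
  have hrow : ∀ j : Fin n, diagBox i (lo + j) ∈ D ∨ diagBox (i + 1) (lo + j - s) ∈ D :=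
    fun j => (hI _).2 ⟨by omega, by omega⟩
  choose S hSP hSx hSy hSstart hSend using fun j => hP.exists_strip_of_row hs (hrow j)
  subst hW
  let F : Fin n ⊕ stripsAvoiding P i → Set Box := Sum.elim S Subtype.val
  have hne : ∀ (j : Fin n) (w : stripsAvoiding P i), S j ≠ w := by
    intro j w h
    rcases hrow j with hx | hy
    · exact (w.2.2 _ (h ▸ hSx j hx)).1 (boxContent_diagBox _ _)
    · exact (w.2.2 _ (h ▸ hSy j hy)).2 (boxContent_diagBox _ _)
  have hSinj : Function.Injective S := by
    intro j k hjk
    have hBk := hP.isBorderStrip _ (hSP k)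
    have hjk' : lo + (j : ℤ) = lo + (k : ℤ) := by
      by_cases hxj : diagBox i (lo + j) ∈ D
      · have hxj' := hjk ▸ hSx j hxj
        by_cases hxk : diagBox i (lo + k) ∈ D
        · exact diagBox_injective i
            (hBk.content_injOn hxj' (hSx k hxk) (by simp only [boxContent_diagBox]))
        · have hyk := (hrow k).resolve_left hxk
          exact ((hP.diagBox_mem_iff hs (hSP k) hxj' hyk).1 (hSy k hyk)).symm
      · have hyj := (hrow j).resolve_left hxj
        have hyj' := hjk ▸ hSy j hyj
        by_cases hxk : diagBox i (lo + k) ∈ D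
        · exact (hP.diagBox_mem_iff hs (hSP k) (hSx k hxk) hyj).1 hyj'
        · have hyk := (hrow k).resolve_left hxk
          have := diagBox_injective (i + 1)
            (hBk.content_injOn hyj' (hSy k hyk) (by simp only [boxContent_diagBox]))
          omega
    exact Fin.ext (by omega)
  have hFinj : Function.Injective F := by
    rintro (j | w) (k | w') h
    · exact congrArg Sum.inl (hSinj h)
    · exact absurd h (hne j w')
    · exact absurd h.symm (hne k w)
    · exact congrArg Sum.inr (Subtype.ext h)
  have hFrange : Set.range F = Set.range θ := by
    rw [hθP]
    apply Set.Subset.antisymm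
    · rintro _ ⟨j | w, rfl⟩
      · exact hSP j
      · exact w.2.1
    · intro A hA
      have key : ∀ r, diagBox i r ∈ A ∨ diagBox (i + 1) (r - s) ∈ A → A ∈ Set.range F := by
        intro r hr
        have hrD := hr.imp (fun h => hP.subset A hA h) fun h => hP.subset A hA h
        obtain ⟨h1, h2⟩ := (hI r).1 hrD
        obtain ⟨j, rfl⟩ : ∃ j : Fin n, lo + (j : ℤ) = r :=
          ⟨⟨(r - lo).toNat, by omega⟩, by simp only; omega⟩
        refine ⟨Sum.inl j, ?_⟩
        rcases hr with hr | hr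
        · exact hP.eq_of_mem _ (hSP j) A hA _ (hSx j (hP.subset A hA hr)) hr
        · exact hP.eq_of_mem _ (hSP j) A hA _ (hSy j (hP.subset A hA hr)) hr
      by_cases hav : ∀ b ∈ A, boxContent b ≠ i ∧ boxContent b ≠ i + 1
      · exact ⟨Sum.inr ⟨A, hA, hav⟩, rfl⟩
      · push Not at hav
        obtain ⟨b, hb, hbi⟩ := hav
        by_cases h : boxContent b = i
        · exact key b.1 (Or.inl (eq_diagBox h ▸ hb))
        · refine key (b.1 + s) (Or.inr ?_)
          rw [add_sub_cancel_right]
          exact eq_diagBox (hbi h) ▸ hb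
  let e : Fin n ⊕ stripsAvoiding P i ≃ Fin m :=
    (Equiv.ofInjective F hFinj).trans
      ((Equiv.setCongr hFrange).trans (Equiv.ofInjective θ hθ).symm)
  have he : ∀ k, θ (e k) = F k := fun k => by
    exact (Equiv.apply_ofInjective_symm hθ (Equiv.setCongr hFrange ⟨F k, k, rfl⟩)).trans rfl
  rw [← det_kernelMatrix_comp_equiv g (stripStart ∘ θ) (stripEnd ∘ θ) e]
  congr 2
  · ext (j | w)
    · simp only [Function.comp_apply, he, F, Sum.elim_inl, hSstart]
    · simp only [Function.comp_apply, he, F, Sum.elim_inr]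
  · ext (j | w)
    · simp only [Function.comp_apply, he, F, Sum.elim_inl, hSend]
      congr 1
      ring
    · simp only [Function.comp_apply, he, F, Sum.elim_inr]

end Indexing

end IsDirectedDecomposition

end DirectedDecompositions

section Diagonals

theorem Set.Finite.exists_forall_mem_iff {X : Set ℤ} (hX : X.Finite) (hne : X.Nonempty)
    (hconv : X.OrdConnected) : ∃ (a : ℤ) (n : ℕ), ∀ r, r ∈ X ↔ a ≤ r ∧ r < a + n := by
  have h1 := hne.csInf_mem hX
  have h2 := hne.csSup_mem hX
  have hle : sInf X ≤ sSup X := csInf_le hX.bddBelow h2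
  refine ⟨sInf X, (sSup X + 1 - sInf X).toNat, fun r => ⟨fun hr => ?_, fun hr => ?_⟩⟩
  · have := csInf_le hX.bddBelow hr
    have := le_csSup hX.bddAbove hr
    omega
  · exact hconv.out h1 h2 ⟨hr.1, by omega⟩

theorem IsSkewShape.exists_diagonal {D : Set Box} (hD : IsSkewShape D) {c : ℤ}
    (hc : c ∈ boxContent '' D) :
    ∃ (a : ℤ) (n : ℕ), ∀ r, diagBox c r ∈ D ↔ a ≤ r ∧ r < a + n := by
  have hmono : Monotone (diagBox c) := fun r r' h => ⟨h, by simpa [diagBox] using h⟩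
  obtain ⟨b, hb, hbc⟩ := hc
  exact (hD.finite.preimage (diagBox_injective c).injOn).exists_forall_mem_iff
    ⟨b.1, show diagBox c b.1 ∈ D from eq_diagBox hbc ▸ hb⟩
    (hD.ordConnected.preimage_mono hmono)

/-- The rows of two adjacent diagonals of a skew shape interlace. -/
theorem IsSkewShape.exists_adjacent_diagonals {D : Set Box} (hD : IsSkewShape D) {i : ℤ}
    (hi : i ∈ boxContent '' D) (hi' : i + 1 ∈ boxContent '' D) :
    ∃ (a b : ℤ) (n m : ℕ), 0 < n ∧ (∀ r, diagBox i r ∈ D ↔ a ≤ r ∧ r < a + n) ∧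
      (∀ r, diagBox (i + 1) r ∈ D ↔ b ≤ r ∧ r < b + m) ∧
      (b = a ∨ b = a - 1) ∧ (b + m = a + n ∨ b + m = a + n - 1) := by
  obtain ⟨a, n, hX⟩ := hD.exists_diagonal hi
  obtain ⟨b, m, hY⟩ := hD.exists_diagonal hi'
  have hconv := hD.ordConnected
  have hn : 0 < n := by
    obtain ⟨x, hx, hxi⟩ := hi
    have := (hX x.1).1 (eq_diagBox hxi ▸ hx)
    omega
  have hm : 0 < m := by
    obtain ⟨x, hx, hxi⟩ := hi'
    have := (hY x.1).1 (eq_diagBox hxi ▸ hx)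
    omega
  have hup : ∀ r r', diagBox i r ∈ D → diagBox (i + 1) r' ∈ D → r ≤ r' →
      diagBox i r' ∈ D ∧ diagBox (i + 1) r ∈ D := fun r r' hx hy hr =>
    ⟨hconv.out hx hy (by simp only [diagBox, Set.mem_Icc, Prod.mk_le_mk]; omega),
      hconv.out hx hy (by simp only [diagBox, Set.mem_Icc, Prod.mk_le_mk]; omega)⟩
  have hdown : ∀ r r', diagBox i r ∈ D → diagBox (i + 1) r' ∈ D → r' < r →
      diagBox i (r' + 1) ∈ D ∧ diagBox (i + 1) (r - 1) ∈ D := fun r r' hx hy hr =>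
    ⟨hconv.out hy hx (by simp only [diagBox, Set.mem_Icc, Prod.mk_le_mk]; omega),
      hconv.out hy hx (by simp only [diagBox, Set.mem_Icc, Prod.mk_le_mk]; omega)⟩
  simp only [hX, hY] at hup hdown
  refine ⟨a, b, n, m, hn, hX, hY, ?_, ?_⟩
  · have h1 := hup a b (by omega) (by omega)
    have h2 := hdown a b (by omega) (by omega)
    omega
  · have h1 := hup (a + n - 1) (b + m - 1) (by omega) (by omega)
    have h2 := hdown (a + n - 1) (b + m - 1) (by omega) (by omega)
    omega

end Diagonals

section Twist

theorem eq_fin_cons_add (f : ℤ → ℤ) (a : ℤ) (n : ℕ) :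
    (fun j : Fin (n + 1) => f (a + j)) =
      Fin.cons (α := fun _ => ℤ) (f a) fun j : Fin n => f (a + 1 + j) := by
  ext j
  induction j using Fin.cases with
  | zero => simp
  | succ j =>
    rw [Fin.cons_succ, Fin.val_succ]
    congr 1
    push_cast
    ring

theorem eq_fin_snoc_add (f : ℤ → ℤ) (a : ℤ) (n : ℕ) :
    (fun j : Fin (n + 1) => f (a + j)) =
      Fin.snoc (α := fun _ => ℤ) (fun j : Fin n => f (a + j)) (f (a + n)) := by
  ext j
  induction j using Fin.lastCases with
  | last => simp
  | cast j => simp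

theorem IsDirectedDecomposition.det_kernelMatrix_eq_of_twist {D : Set Box} (hD : IsSkewShape D)
    {P P' : Set (Set Box)} {up up' : ℤ → Prop} (hP : IsDirectedDecomposition D P up)
    (hP' : IsDirectedDecomposition D P' up') {i : ℤ} (hi : i ∈ boxContent '' D)
    (hi' : i + 1 ∈ boxContent '' D) (hupi : ¬ up i) (hupi' : up' i)
    (hup : ∀ c, c ≠ i → (up c ↔ up' c)) {R : Type*} [CommRing R] {g g' : ℤ → ℤ → R}
    (hg : IsTwistedPair i g g') {m m' : ℕ} {θ : Fin m → Set Box} {θ' : Fin m' → Set Box}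
    (hθ : Function.Injective θ) (hθP : Set.range θ = P)
    (hθ' : Function.Injective θ') (hθP' : Set.range θ' = P') :
    (kernelMatrix g (stripStart ∘ θ) (stripEnd ∘ θ)).det =
      (kernelMatrix g' (stripStart ∘ θ') (stripEnd ∘ θ')).det := by
  classical
  obtain ⟨a, b, N, M, hN, hX, hY, hlo, hhi⟩ := hD.exists_adjacent_diagonals hi hi'
  have hWfin : (stripsAvoiding P i).Finite :=
    (Set.finite_range θ).subset fun S hS => hθP ▸ hS.1
  have := hWfin.fintype
  have hdet := fun (n : ℕ) (hn : b + n = a + N) => hP.det_kernelMatrix_strips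
    (boxNext_diagBox_of_not_up hupi) g (lo := b) (n := n)
    (fun r => by rw [hX, hY]; omega) rfl hθ hθP
  have hdet' := fun (n : ℕ) (hn : a + n = b + M + 1) => hP'.det_kernelMatrix_strips
    (boxNext_diagBox_of_up hupi') g' (lo := a) (n := n)
    (fun r => by rw [hX, hY]; omega) (hP.stripsAvoiding_eq hP' hup).symm hθ' hθP'
  simp only [← hP.startAt_eq hP' hup, ← hP.endAt_eq hP' hup] at hdet'
  have hs : ∀ r, a ≤ r ∧ r < a + N → startAt D P i r ≤ i := fun r hr => hP.startAt_le ((hX r).2 hr)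
  have he : ∀ r, b ≤ r ∧ r < b + M → i < endAt D P i r := fun r hr => hP.lt_endAt ((hY r).2 hr)
  have hs' : ∀ r, ¬ (a ≤ r ∧ r < a + N) → startAt D P i r = i + 1 :=
    fun r hr => if_neg fun h => hr ((hX r).1 h)
  have he' : ∀ r, ¬ (b ≤ r ∧ r < b + M) → endAt D P i r = i :=
    fun r hr => if_neg fun h => hr ((hY r).1 h)
  have hW : ∀ w : stripsAvoiding P i, stripEnd w < i ∨ i + 1 < stripStart w :=
    fun w => hP.stripsAvoiding_spec w.2
  have hpqW : ∀ w : stripsAvoiding P i, stripStart w ≤ stripEnd w :=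
    fun w => hP.stripStart_le_stripEnd w.2.1
  rcases hlo with hlo | hlo <;> rcases hhi with hhi | hhi
  · obtain rfl : M = N := by omega
    subst hlo
    rw [hdet M rfl, hdet' (M + 1) (by push_cast; ring), eq_fin_snoc_add (startAt D P i),
      eq_fin_cons_add (endAt D P i),
      hs' _ (by omega), he' _ (by omega)]
    simp only [sub_add_cancel, sub_zero]
    exact (hg.symm.det_snoc_cons hW hpqW (fun l => hs _ (by omega)) fun k => he _ (by omega)).symm
  · obtain rfl : N = M + 1 := by omega
    subst hlo
    rw [hdet (M + 1) rfl, hdet' (M + 1) (by push_cast; ring), eq_fin_snoc_add (endAt D P i),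
      eq_fin_cons_add (endAt D P i), he' _ (by omega), he' _ (by omega)]
    simp only [sub_add_cancel, sub_zero]
    exact hg.det_shift_end hW hpqW (fun l => hs _ (by omega)) fun k => he _ (by omega)
  · obtain rfl : M = N + 1 := by omega
    subst hlo
    rw [hdet (N + 1) (by push_cast; ring), hdet' (N + 1) (by push_cast; ring),
      eq_fin_snoc_add (startAt D P i) a, eq_fin_cons_add (startAt D P i) (a - 1),
      hs' _ (by omega), hs' _ (by omega)]
    simp only [sub_add_cancel, sub_zero]
    exact hg.det_shift_start hW hpqW (fun l => hs _ (by omega)) fun k => he _ (by omega)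
  · obtain rfl : M = N := by omega
    subst hlo
    rw [hdet (M + 1) (by push_cast; ring), hdet' M (by ring), eq_fin_cons_add (startAt D P i),
      eq_fin_snoc_add (endAt D P i),
      hs' _ (by omega), he' _ (by omega)]
    simp only [sub_add_cancel, sub_zero]
    exact hg.det_cons_snoc hW hpqW (fun l => hs _ (by omega)) fun k => he _ (by omega)

end Twist

/-- The Hamel–Goulden determinant is invariant under the twist
transformation: if the outside decompositions `Π` (with data `θ, pθ, qθ, p, T`) and
`ω_i(Π)` (with data `θ', pθ', qθ', p', T'`) of an edgewise connected skew diagram `D` have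
cutting strips related by twisting the box labeled by the non-maximal content `i`, then
`D(Π) = D(ω_i(Π))`. -/
theorem twist_determinant_invariance
    (D : Set Box) (hD : IsSkewShape D) (hne : D.Nonempty) (hconn : EdgewiseConnected D)
    (i : ℤ) (hi : i ∈ boxContent '' D) (hi' : i + 1 ∈ boxContent '' D)
    (m : ℕ) (θ : Fin m → Set Box) (hθinj : Function.Injective θ)
    (hP : IsOutsideDecomposition D (Set.range θ))
    (pθ qθ : Fin m → ℤ) (hpq : ∀ k : Fin m, HasPQ (θ k) (pθ k) (qθ k))
    (hqmono : ∀ k l : Fin m, k < l → qθ l < qθ k)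
    (p : Fin m → ℤ) (hpmono : ∀ k l : Fin m, k < l → p l < p k)
    (hperm : ∃ τ : Equiv.Perm (Fin m), p = pθ ∘ τ)
    (T : Set Box) (hT : IsCuttingStripOf D (Set.range θ) T)
    (n : ℕ) (θ' : Fin n → Set Box) (hθ'inj : Function.Injective θ')
    (hP' : IsOutsideDecomposition D (Set.range θ'))
    (pθ' qθ' : Fin n → ℤ) (hpq' : ∀ k : Fin n, HasPQ (θ' k) (pθ' k) (qθ' k))
    (hq'mono : ∀ k l : Fin n, k < l → qθ' l < qθ' k)
    (p' : Fin n → ℤ) (hp'mono : ∀ k l : Fin n, k < l → p' l < p' k)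
    (hperm' : ∃ τ : Equiv.Perm (Fin n), p' = pθ' ∘ τ)
    (T' : Set Box) (hT' : IsCuttingStripOf D (Set.range θ') T')
    (htwist : IsTwist i T T') :
    (-1 : MvPowerSeries ℕ ℤ) ^ invOD (Set.range θ) *
        Matrix.det (Matrix.of fun k l : Fin m =>
          if p l ≤ qθ k + 1 then schur (stripSegment T (p l) (qθ k)) else 0) =
      (-1 : MvPowerSeries ℕ ℤ) ^ invOD (Set.range θ') *
        Matrix.det (Matrix.of fun k l : Fin n =>
          if p' l ≤ qθ' k + 1 then schur (stripSegment T' (p' l) (qθ' k)) else 0) := by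
  have hdet : ∀ {r : ℕ} {σ : Fin r → Set Box} {pσ qσ p : Fin r → ℤ} {S : Set Box},
      IsOutsideDecomposition D (Set.range σ) → (∀ k, HasPQ (σ k) (pσ k) (qσ k)) →
      (∀ k l, k < l → qσ l < qσ k) → Function.Injective σ → (∀ k l, k < l → p l < p k) →
      (∃ τ : Equiv.Perm (Fin r), p = pσ ∘ τ) →
      (-1 : MvPowerSeries ℕ ℤ) ^ invOD (Set.range σ) *
          Matrix.det (Matrix.of fun k l : Fin r =>
            if p l ≤ qσ k + 1 then schur (stripSegment S (p l) (qσ k)) else 0) =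
        (kernelMatrix (stripKernel S) (stripStart ∘ σ) (stripEnd ∘ σ)).det := by
    intro r σ pσ qσ p S hσ hσpq hσq hσinj hσp hσperm
    have hstrip := fun k => (hσ.1 (σ k) ⟨k, rfl⟩).1
    refine (neg_one_pow_invOD_mul_det (stripKernel S) hσinj hstrip hσpq hσq hσp hσperm).trans ?_
    congr 2
    · exact funext fun k =>
        ((hstrip k).isLeast_of_hasPQ (hσpq k)).unique (hstrip k).isLeast_stripStart
    · exact funext fun k =>
        ((hstrip k).isGreatest_of_hasPQ (hσpq k)).unique (hstrip k).isGreatest_stripEnd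
  rw [hdet hP hpq hqmono hθinj hpmono hperm, hdet hP' hpq' hq'mono hθ'inj hp'mono hperm']
  obtain ⟨hcont, hdir, hdiri⟩ := htwist
  have hc := hT.2.1
  have hc' := hT'.2.1
  rw [hT'.1.stripGoesRightAt_iff_not_up (hc'.symm ▸ hi) (hc'.symm ▸ hi')] at hdiri
  have hdir₁ := hP.isDirectedDecomposition hT
  have hdir₂ := hP'.isDirectedDecomposition hT'
  by_cases hup : StripGoesUpAt T i
  · have hup' := hdiri.1 hup
    have hdir' := fun c hci => (hdir c hci).symm
    exact (hdir₂.det_kernelMatrix_eq_of_twist hD hdir₁ hi hi' hup' hup hdir'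
      (isTwistedPair_stripKernel hT'.1 hT.1 hcont.symm (hc'.symm ▸ hi) (hc'.symm ▸ hi')
        hup' hup hdir') hθ'inj rfl hθinj rfl).symm
  · have hup' := not_not.1 fun h => hup (hdiri.2 h)
    exact hdir₁.det_kernelMatrix_eq_of_twist hD hdir₂ hi hi' hup hup' hdir
      (isTwistedPair_stripKernel hT.1 hT'.1 hcont (hc.symm ▸ hi) (hc.symm ▸ hi')
        hup hup' hdir) hθinj rfl hθ'inj rfl
end
end

section
/- Let λ/μ be an edgewise connected skew diagram. For any two outside decompositions Π and Π′ of λ/μ, there exists a finite sequence of contents i_1, …, i_s (each non-maximal for λ/μ) such that ω_{i_s}(⋯(ω_{i_2}(ω_{i_1}(Π)))⋯) = Π′, where ω_i denotes the twist transformation. -/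
noncomputable section

/-- A finite order-convex set of boxes with positive coordinates is a skew diagram. -/
theorem isSkewShape_of_finite_of_ordConnected {B : Set Box} (hfin : B.Finite)
    (hB : B.OrdConnected) (hpos : ∀ b ∈ B, 1 ≤ b.1 ∧ 1 ≤ b.2) : IsSkewShape B := by
  obtain ⟨u, hu⟩ := hfin.bddAbove
  set L : ℕ → Set ℕ := fun i => {j | ∃ b ∈ B, (i : ℤ) ≤ b.1 ∧ b.2 = j} with hL
  have hLb : ∀ i, BddAbove (L i) := fun i => ⟨u.2.toNat, by
    rintro j ⟨b, hb, -, hj⟩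
    have := (hu hb).2
    omega⟩
  set M : ℕ → Set ℕ := fun i => {j | j ≤ sSup (L i) ∧ ∀ b ∈ B, b.1 ≤ i → (j : ℤ) < b.2} with hM
  have hMb : ∀ i, BddAbove (M i) := fun i => ⟨sSup (L i), fun j hj => hj.1⟩
  have hM0 : ∀ i, (M i).Nonempty := fun i => ⟨0, Nat.zero_le _, fun b hb _ => by
    have := (hpos b hb).2
    omega⟩
  have hLanti : ∀ ⦃i j : ℕ⦄, i ≤ j → sSup (L j) ≤ sSup (L i) := fun i j hij =>
    csSup_le_csSup' (hLb i) (by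
      rintro k ⟨b, hb, h1, h2⟩
      exact ⟨b, hb, by omega, h2⟩)
  have hMle : ∀ i, sSup (M i) ≤ sSup (L i) := fun i => csSup_le' fun j hj => hj.1
  have hLz : ∀ i : ℕ, u.1.toNat + 1 ≤ i → sSup (L i) = 0 := fun i hi => by
    have : L i = ∅ := by
      ext j
      simp only [hL, Set.mem_ofPred_eq, Set.mem_empty_iff_false, iff_false]
      rintro ⟨b, hb, h1, -⟩
      have := (hu hb).1
      omega
    simp [this]
  refine ⟨⟨fun i => sSup (L i), hLanti, u.1.toNat + 1, hLz⟩,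
    ⟨fun i => sSup (M i), fun i j hij => csSup_le_csSup' (hMb i) ?_, u.1.toNat + 1, ?_⟩,
    hMle, ?_⟩
  · rintro k ⟨h1, h2⟩
    exact ⟨h1.trans (hLanti hij), fun b hb h => h2 b hb (by omega)⟩
  · intro i hi
    have := hMle i
    have := hLz i hi
    omega
  · ext ⟨i, j⟩
    simp only [skewCells, Set.mem_ofPred_eq]
    constructor
    · intro hb
      have hp := hpos _ hb
      simp only at hp
      refine ⟨hp.1, (Nat.sSup_mem (hM0 _) (hMb _)).2 _ hb (by simp only; omega), ?_⟩
      have := le_csSup (hLb i.toNat) (show j.toNat ∈ L i.toNat from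
        ⟨(i, j), hb, by simp only; omega, by simp only; omega⟩)
      omega
    · rintro ⟨hi, h1, h2⟩
      have hne : (L i.toNat).Nonempty := by
        by_contra hne
        rw [Set.not_nonempty_iff_eq_empty] at hne
        simp only [hne, csSup_empty, bot_eq_zero] at h2
        omega
      obtain ⟨b, hb, hb1, hb2⟩ := Nat.sSup_mem hne (hLb _)
      have hj : j.toNat ∉ M i.toNat := fun h => by
        have := le_csSup (hMb _) h
        omega
      have hj' : ∃ a ∈ B, a.1 ≤ i ∧ a.2 ≤ j := by
        by_contra! hcon
        refine hj ⟨by omega, fun b hb h => ?_⟩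
        have := hcon b hb (by omega)
        omega
      obtain ⟨a, ha, ha1, ha2⟩ := hj'
      exact hB.out ha hb ⟨⟨ha1, ha2⟩, ⟨by simp only; omega, by simp only; omega⟩⟩

theorem isSkewLike_of_finite_of_ordConnected {B : Set Box} (hfin : B.Finite)
    (hB : B.OrdConnected) : IsSkewLike B := by
  obtain ⟨l, hl⟩ := hfin.bddBelow
  refine ⟨(1 - l.1, 1 - l.2), isSkewShape_of_finite_of_ordConnected (hfin.image _) ⟨?_⟩ ?_⟩
  · rintro _ ⟨a, ha, rfl⟩ _ ⟨b, hb, rfl⟩ c ⟨h1, h2⟩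
    refine ⟨c - (1 - l.1, 1 - l.2), hB.out ha hb ⟨?_, ?_⟩, sub_add_cancel _ _⟩
    · exact le_sub_iff_add_le.2 h1
    · exact sub_le_iff_le_add.2 h2
  · rintro _ ⟨b, hb, rfl⟩
    have := hl hb
    have h1 := this.1
    have h2 := this.2
    simp only [Prod.fst_add, Prod.snd_add]
    omega

/-- In an edgewise connected set, a step from a box of content at most `c` to a box of larger
content occurs between a box of content `c` and an upper or right neighbour. -/
theorem exists_step_of_content_le {D : Set Box} (hD : EdgewiseConnected D) {a b : Box}
    (ha : a ∈ D) (hb : b ∈ D) {c : ℤ} (hac : boxContent a ≤ c) (hcb : c < boxContent b) :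
    ∃ e ∈ D, boxContent e = c ∧ ((e.1 - 1, e.2) ∈ D ∨ (e.1, e.2 + 1) ∈ D) := by
  induction hD a ha b hb using Relation.ReflTransGen.head_induction_on with
  | refl => omega
  | @head x y hxy _ ih =>
    obtain ⟨hx, hy, hadj⟩ := hxy
    by_cases hyc : boxContent y ≤ c
    · exact ih hy hyc
    · refine ⟨x, hx, ?_⟩
      obtain ⟨x1, x2⟩ := x
      obtain ⟨y1, y2⟩ := y
      simp only [boxContent, boxAdj] at *
      refine ⟨by omega, ?_⟩
      rcases hadj with ⟨rfl, h⟩ | ⟨rfl, h⟩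
      · right
        obtain rfl : y2 = x2 + 1 := by omega
        exact hy
      · left
        obtain rfl : y1 = x1 - 1 := by omega
        exact hy

theorem EdgewiseConnected.ordConnected_content {D : Set Box} (hD : EdgewiseConnected D) :
    (boxContent '' D).OrdConnected := by
  refine ⟨?_⟩
  rintro _ ⟨a, ha, rfl⟩ _ ⟨b, hb, rfl⟩ c ⟨hac, hcb⟩
  rcases hcb.eq_or_lt with rfl | hcb
  · exact ⟨b, hb, rfl⟩
  · obtain ⟨e, he, hec, -⟩ := exists_step_of_content_le hD ha hb hac hcb
    exact ⟨e, he, hec⟩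

theorem IsBorderStrip.eq_of_content_eq {B : Set Box} (hB : IsBorderStrip B) {a b : Box}
    (ha : a ∈ B) (hb : b ∈ B) (hab : boxContent a = boxContent b) : a = b := by
  wlog h : a.1 ≤ b.1 generalizing a b
  · exact (this hb ha hab.symm (by omega)).symm
  obtain ⟨a1, a2⟩ := a
  obtain ⟨b1, b2⟩ := b
  simp only [boxContent] at hab h
  rcases h.eq_or_lt with rfl | h
  · simp only [Prod.mk.injEq, true_and]
    omega
  · have hout := hB.2.1.ordConnected.out ha hb
    exact (hB.2.2.2 (a1, a2) ⟨ha,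
      hout ⟨⟨by simp, by simp⟩, ⟨by simp only; omega, by simp only; omega⟩⟩,
      hout ⟨⟨by simp, by simp⟩, ⟨by simp only; omega, by simp only; omega⟩⟩,
      hout ⟨⟨by simp, by simp⟩, ⟨by simp only; omega, by simp only; omega⟩⟩⟩).elim

/-- A lattice path: `x c` is the row of its box of content `c`, and the path goes up or right
at every content. -/
def IsLatticePath (x : ℤ → ℤ) : Prop := ∀ c, x (c + 1) = x c ∨ x (c + 1) = x c - 1

/-- The box of content `c` on the path `x` shifted diagonally by `k`. -/
def pathBox (x : ℤ → ℤ) (k c : ℤ) : Box := (x c + k, x c + k + c)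

/-- The diagonal shift of the path `x` that passes through the box `b`. -/
def pathOffset (x : ℤ → ℤ) (b : Box) : ℤ := b.1 - x (boxContent b)

@[simp] theorem boxContent_pathBox (x : ℤ → ℤ) (k c : ℤ) : boxContent (pathBox x k c) = c := by
  simp [boxContent, pathBox]

@[simp] theorem pathOffset_pathBox (x : ℤ → ℤ) (k c : ℤ) : pathOffset x (pathBox x k c) = k := by
  simp [pathOffset]
  simp [pathBox]

@[simp] theorem pathBox_pathOffset (x : ℤ → ℤ) (b : Box) :
    pathBox x (pathOffset x b) (boxContent b) = b := by
  simp [pathBox, pathOffset, boxContent]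

theorem IsLatticePath.antitone {x : ℤ → ℤ} (hx : IsLatticePath x) : Antitone x :=
  antitone_int_of_succ_le fun c => by rcases hx c with h | h <;> omega

theorem IsLatticePath.monotone_add {x : ℤ → ℤ} (hx : IsLatticePath x) :
    Monotone fun c => x c + c :=
  monotone_int_of_le_succ fun c => by rcases hx c with h | h <;> omega

theorem IsLatticePath.boxAdj_pathBox {x : ℤ → ℤ} (hx : IsLatticePath x) (k c : ℤ) :
    boxAdj (pathBox x k c) (pathBox x k (c + 1)) := by
  simp only [boxAdj, pathBox]
  rcases hx c with h | h <;> omega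

theorem boxAdj.symm {a b : Box} (h : boxAdj a b) : boxAdj b a := by
  simp only [boxAdj] at *
  omega

theorem IsLatticePath.isBorderStrip_image {x : ℤ → ℤ} (hx : IsLatticePath x) (k : ℤ) {S : Set ℤ}
    (hfin : S.Finite) (hS : S.OrdConnected) (hne : S.Nonempty) :
    IsBorderStrip (pathBox x k '' S) := by
  refine ⟨hne.image _, isSkewLike_of_finite_of_ordConnected (hfin.image _) ⟨?_⟩, ?_, ?_⟩
  · rintro _ ⟨c, hc, rfl⟩ _ ⟨d, hd, rfl⟩ ⟨i, j⟩ ⟨⟨h1, h2⟩, ⟨h3, h4⟩⟩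
    simp only [pathBox] at h1 h2 h3 h4
    rcases le_total c d with hcd | hcd
    · have hr := hx.antitone hcd
      have h5 := hx.antitone (show c ≤ j - i by omega)
      have h6 := hx.antitone (show j - i ≤ d by omega)
      refine ⟨j - i, hS.out hc hd ⟨by omega, by omega⟩, ?_⟩
      simp only [pathBox, Prod.mk.injEq]
      omega
    · have hr := hx.monotone_add hcd
      have h5 := hx.monotone_add (show j - i ≤ c by simp only at hr; omega)
      have h6 := hx.monotone_add (show d ≤ j - i by simp only at hr; omega)
      simp only at hr h5 h6
      refine ⟨j - i, hS.out hd hc ⟨by omega, by omega⟩, ?_⟩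
      simp only [pathBox, Prod.mk.injEq]
      omega
  · set R : Box → Box → Prop :=
      fun a b => a ∈ pathBox x k '' S ∧ b ∈ pathBox x k '' S ∧ boxAdj a b with hR
    have hsymm : Std.Symm R := ⟨fun a b h => ⟨h.2.1, h.1, h.2.2.symm⟩⟩
    have key : ∀ c ∈ S, ∀ d ∈ S, c ≤ d → Relation.ReflTransGen R (pathBox x k c) (pathBox x k d) := by
      intro c hc d hd hcd
      induction d, hcd using Int.leInduction with
      | base => exact .refl
      | succ d hcd ih =>
        have hd' : d ∈ S := hS.out hc hd ⟨hcd, by omega⟩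
        exact (ih hd').tail ⟨⟨d, hd', rfl⟩, ⟨d + 1, hd, rfl⟩, hx.boxAdj_pathBox k d⟩
    rintro _ ⟨c, hc, rfl⟩ _ ⟨d, hd, rfl⟩
    rcases le_total c d with hcd | hcd
    · exact key c hc d hd hcd
    · exact Relation.ReflTransGen.stdSymm.symm _ _ (key d hd c hc hcd)
  · rintro ⟨i, j⟩ ⟨⟨c, -, hc⟩, -, -, ⟨d, -, hd⟩⟩
    simp only [pathBox, Prod.mk.injEq] at hc hd
    obtain rfl : c = d := by omega
    omega

/-- The strip through `b` cut out of `D` by the diagonal shifts of the path `x`. -/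
def pathStrip (D : Set Box) (x : ℤ → ℤ) (b : Box) : Set Box :=
  pathBox x (pathOffset x b) ''
    {c | ∀ a ∈ Set.uIcc (boxContent b) c, pathBox x (pathOffset x b) a ∈ D}

/-- The decomposition of `D` cut out by the diagonal shifts of the path `x`. -/
def pathDecomposition (D : Set Box) (x : ℤ → ℤ) : Set (Set Box) := pathStrip D x '' D

theorem mem_pathStrip {D : Set Box} {x : ℤ → ℤ} {b e : Box} :
    e ∈ pathStrip D x b ↔ pathOffset x e = pathOffset x b ∧
      ∀ c ∈ Set.uIcc (boxContent b) (boxContent e), pathBox x (pathOffset x b) c ∈ D := by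
  constructor
  · rintro ⟨c, hc, rfl⟩
    simpa using hc
  · rintro ⟨h1, h2⟩
    exact ⟨boxContent e, h2, by rw [← h1, pathBox_pathOffset]⟩

theorem self_mem_pathStrip {D : Set Box} {x : ℤ → ℤ} {b : Box} (hb : b ∈ D) :
    b ∈ pathStrip D x b := by
  simpa [mem_pathStrip] using hb

theorem pathStrip_subset {D : Set Box} {x : ℤ → ℤ} {b : Box} : pathStrip D x b ⊆ D := by
  rintro _ ⟨c, hc, rfl⟩
  exact hc c Set.right_mem_uIcc

theorem pathStrip_symm {D : Set Box} {x : ℤ → ℤ} {b e : Box} (h : e ∈ pathStrip D x b) :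
    b ∈ pathStrip D x e := by
  rw [mem_pathStrip] at *
  rw [h.1, Set.uIcc_comm]
  exact ⟨rfl, h.2⟩

theorem pathStrip_trans {D : Set Box} {x : ℤ → ℤ} {b e f : Box} (h : e ∈ pathStrip D x b)
    (h' : f ∈ pathStrip D x e) : f ∈ pathStrip D x b := by
  rw [mem_pathStrip] at *
  refine ⟨h'.1.trans h.1, fun c hc => ?_⟩
  rcases Set.uIcc_subset_uIcc_union_uIcc (b := boxContent e) hc with hc | hc
  · exact h.2 c hc
  · exact h.1 ▸ h'.2 c hc

theorem pathStrip_eq {D : Set Box} {x : ℤ → ℤ} {b e : Box} (h : e ∈ pathStrip D x b) :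
    pathStrip D x e = pathStrip D x b :=
  Set.ext fun _ => ⟨fun h' => pathStrip_trans h h', fun h' => pathStrip_trans (pathStrip_symm h) h'⟩

theorem pathBox_succ_mem_pathStrip {D : Set Box} {x : ℤ → ℤ} {k c : ℤ} (h : pathBox x k c ∈ D)
    (h' : pathBox x k (c + 1) ∈ D) : pathBox x k (c + 1) ∈ pathStrip D x (pathBox x k c) := by
  simp only [mem_pathStrip, pathOffset_pathBox, boxContent_pathBox, true_and]
  intro a ha
  rw [Set.uIcc_of_le (by omega), Set.mem_Icc] at ha
  obtain rfl | rfl : a = c ∨ a = c + 1 := by omega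
  · exact h
  · exact h'

theorem pathBox_succ_of_up {x : ℤ → ℤ} {b : Box} (h : x (boxContent b + 1) = x (boxContent b) - 1) :
    pathBox x (pathOffset x b) (boxContent b + 1) = (b.1 - 1, b.2) := by
  simp only [pathBox, pathOffset, h, Prod.mk.injEq]
  simp only [boxContent]
  omega

theorem pathBox_succ_of_right {x : ℤ → ℤ} {b : Box} (h : x (boxContent b + 1) = x (boxContent b)) :
    pathBox x (pathOffset x b) (boxContent b + 1) = (b.1, b.2 + 1) := by
  simp only [pathBox, pathOffset, h, Prod.mk.injEq]
  simp only [boxContent]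
  omega

theorem up_mem_pathStrip {D : Set Box} {x : ℤ → ℤ} {b : Box} (hb : b ∈ D)
    (h : x (boxContent b + 1) = x (boxContent b) - 1) (hu : (b.1 - 1, b.2) ∈ D) :
    (b.1 - 1, b.2) ∈ pathStrip D x b := by
  have := @pathBox_succ_mem_pathStrip D x (pathOffset x b) (boxContent b)
  rw [pathBox_succ_of_up h, pathBox_pathOffset] at this
  exact this hb hu

theorem right_mem_pathStrip {D : Set Box} {x : ℤ → ℤ} {b : Box} (hb : b ∈ D)
    (h : x (boxContent b + 1) = x (boxContent b)) (hr : (b.1, b.2 + 1) ∈ D) :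
    (b.1, b.2 + 1) ∈ pathStrip D x b := by
  have := @pathBox_succ_mem_pathStrip D x (pathOffset x b) (boxContent b)
  rw [pathBox_succ_of_right h, pathBox_pathOffset] at this
  exact this hb hr

theorem pathStrip_mem_pathDecomposition {D : Set Box} {x : ℤ → ℤ} {b : Box} (hb : b ∈ D) :
    pathStrip D x b ∈ pathDecomposition D x :=
  ⟨b, hb, rfl⟩

theorem IsLatticePath.isBorderStrip_pathStrip {D : Set Box} {x : ℤ → ℤ} (hx : IsLatticePath x)
    (hfin : D.Finite) {b : Box} (hb : b ∈ D) : IsBorderStrip (pathStrip D x b) := by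
  refine hx.isBorderStrip_image _ ((hfin.image boxContent).subset fun c hc => ?_) ⟨?_⟩ ⟨boxContent b, ?_⟩
  · exact ⟨_, hc c Set.right_mem_uIcc, boxContent_pathBox _ _ _⟩
  · intro c hc d hd e he a ha
    by_cases h : a ∈ Set.uIcc (boxContent b) c
    · exact hc a h
    · refine hd a ?_
      simp only [Set.mem_uIcc, Set.mem_Icc] at *
      omega
  · intro c hc
    rw [Set.uIcc_self, Set.mem_singleton_iff] at hc
    rwa [hc, pathBox_pathOffset]

theorem IsLatticePath.isOutsideDecomposition {D : Set Box} {x : ℤ → ℤ} (hx : IsLatticePath x)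
    (hfin : D.Finite) : IsOutsideDecomposition D (pathDecomposition D x) := by
  refine ⟨?_, ?_, ?_, ?_⟩
  · rintro _ ⟨b, hb, rfl⟩
    exact ⟨hx.isBorderStrip_pathStrip hfin hb, pathStrip_subset⟩
  · intro b hb
    refine ⟨_, ⟨pathStrip_mem_pathDecomposition hb, self_mem_pathStrip hb⟩, ?_⟩
    rintro _ ⟨⟨e, he, rfl⟩, h⟩
    exact (pathStrip_eq h).symm
  · rintro _ ⟨a, ha, rfl⟩ b ⟨hb, hl, hd⟩
    by_contra! hcon
    obtain ⟨hl', hd'⟩ := hcon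
    have hc1 : boxContent (b.1, b.2 - 1) + 1 = boxContent b := by simp only [boxContent]; omega
    have hc2 : boxContent (b.1 + 1, b.2) + 1 = boxContent b := by simp only [boxContent]; omega
    have hc3 : boxContent (b.1 + 1, b.2) = boxContent (b.1, b.2 - 1) := by omega
    rcases hx (boxContent (b.1, b.2 - 1)) with h | h
    · have := right_mem_pathStrip (b := (b.1, b.2 - 1)) hl' h (by simpa using pathStrip_subset hb)
      simp only [sub_add_cancel] at this
      exact hl (pathStrip_trans hb (pathStrip_symm this))
    · have := up_mem_pathStrip (x := x) (b := (b.1 + 1, b.2)) hd' (by rw [hc3, h])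
        (by simpa using pathStrip_subset hb)
      simp only [add_sub_cancel_right] at this
      exact hd (pathStrip_trans hb (pathStrip_symm this))
  · rintro _ ⟨a, ha, rfl⟩ b ⟨hb, hu, hr⟩
    by_contra! hcon
    rcases hx (boxContent b) with h | h
    · exact hr (pathStrip_trans hb (right_mem_pathStrip (pathStrip_subset hb) h hcon.2))
    · exact hu (pathStrip_trans hb (up_mem_pathStrip (pathStrip_subset hb) h hcon.1))

/-- If a box of a skew diagram has no box above it and none to its right, then the diagram has no
box on the next diagonal. -/
theorem IsSkewShape.content_succ_notMem {D : Set Box} (hD : IsSkewShape D) {b : Box} (hb : b ∈ D)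
    (hu : (b.1 - 1, b.2) ∉ D) (hr : (b.1, b.2 + 1) ∉ D) : boxContent b + 1 ∉ boxContent '' D := by
  obtain ⟨lam, mu, -, rfl⟩ := hD
  obtain ⟨i, j⟩ := b
  rintro ⟨⟨i', j'⟩, ⟨h1, h2, h3⟩, hc⟩
  obtain ⟨g1, g2, g3⟩ := hb
  simp only [boxContent, skewCells, Set.mem_ofPred_eq, not_and] at *
  rcases le_or_gt i i' with h | h
  · have := lam.antitone (show i.toNat ≤ i'.toNat by omega)
    exact hr g1 (by omega) (by omega)
  · have := mu.antitone (show i'.toNat ≤ (i - 1).toNat by omega)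
    have := lam.antitone (show (i - 1).toNat ≤ i.toNat by omega)
    exact hu (by omega) (by omega) (by omega)

/-- The part of the path `x` whose contents are those of `D`. -/
def pathCuttingStrip (D : Set Box) (x : ℤ → ℤ) : Set Box := pathBox x 0 '' (boxContent '' D)

theorem boxContent_image_pathCuttingStrip (D : Set Box) (x : ℤ → ℤ) :
    boxContent '' pathCuttingStrip D x = boxContent '' D := by
  simp [pathCuttingStrip, Set.image_image]

theorem up_mem_pathCuttingStrip {D : Set Box} {x : ℤ → ℤ} {c : ℤ} :
    ((pathBox x 0 c).1 - 1, (pathBox x 0 c).2) ∈ pathCuttingStrip D x ↔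
      c + 1 ∈ boxContent '' D ∧ x (c + 1) = x c - 1 := by
  constructor
  · rintro ⟨d, hd, h⟩
    simp only [pathBox, Prod.mk.injEq] at h
    obtain rfl : d = c + 1 := by omega
    exact ⟨hd, by omega⟩
  · rintro ⟨h1, h2⟩
    refine ⟨c + 1, h1, ?_⟩
    simp only [pathBox, Prod.mk.injEq]
    omega

theorem right_mem_pathCuttingStrip {D : Set Box} {x : ℤ → ℤ} {c : ℤ} :
    ((pathBox x 0 c).1, (pathBox x 0 c).2 + 1) ∈ pathCuttingStrip D x ↔
      c + 1 ∈ boxContent '' D ∧ x (c + 1) = x c := by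
  constructor
  · rintro ⟨d, hd, h⟩
    simp only [pathBox, Prod.mk.injEq] at h
    obtain rfl : d = c + 1 := by omega
    exact ⟨hd, by omega⟩
  · rintro ⟨h1, h2⟩
    refine ⟨c + 1, h1, ?_⟩
    simp only [pathBox, Prod.mk.injEq]
    omega

theorem stripGoesUpAt_pathCuttingStrip {D : Set Box} {x : ℤ → ℤ} {c : ℤ} :
    StripGoesUpAt (pathCuttingStrip D x) c ↔
      c ∈ boxContent '' D ∧ c + 1 ∈ boxContent '' D ∧ x (c + 1) = x c - 1 := by
  constructor
  · rintro ⟨_, ⟨d, hd, rfl⟩, rfl, h⟩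
    rw [boxContent_pathBox]
    exact ⟨hd, up_mem_pathCuttingStrip.1 h⟩
  · rintro ⟨h1, h2⟩
    exact ⟨_, ⟨c, h1, rfl⟩, boxContent_pathBox _ _ _, up_mem_pathCuttingStrip.2 h2⟩

theorem stripGoesRightAt_pathCuttingStrip {D : Set Box} {x : ℤ → ℤ} {c : ℤ} :
    StripGoesRightAt (pathCuttingStrip D x) c ↔
      c ∈ boxContent '' D ∧ c + 1 ∈ boxContent '' D ∧ x (c + 1) = x c := by
  constructor
  · rintro ⟨_, ⟨d, hd, rfl⟩, rfl, h⟩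
    rw [boxContent_pathBox]
    exact ⟨hd, right_mem_pathCuttingStrip.1 h⟩
  · rintro ⟨h1, h2⟩
    exact ⟨_, ⟨c, h1, rfl⟩, boxContent_pathBox _ _ _, right_mem_pathCuttingStrip.2 h2⟩

theorem IsLatticePath.isCuttingStripOf {D : Set Box} {x : ℤ → ℤ} (hx : IsLatticePath x)
    (hD : IsSkewShape D) (hne : D.Nonempty) (hconn : EdgewiseConnected D) :
    IsCuttingStripOf D (pathDecomposition D x) (pathCuttingStrip D x) := by
  refine ⟨hx.isBorderStrip_image 0 (hD.finite.image _) hconn.ordConnected_content (hne.image _),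
    boxContent_image_pathCuttingStrip D x, ?_⟩
  rintro _ ⟨c, -, rfl⟩ b hb hbc
  rw [boxContent_pathBox] at hbc
  subst hbc
  rw [up_mem_pathCuttingStrip, right_mem_pathCuttingStrip]
  have hcontent : boxContent (b.1 - 1, b.2) = boxContent (b.1, b.2 + 1) := by
    simp only [boxContent]
    omega
  have hne' : ((b.1 - 1, b.2) : Box) ≠ (b.1, b.2 + 1) := by simp
  have huniq := fun h h' => hne' ((hx.isBorderStrip_pathStrip hD.finite hb).eq_of_content_eq h h' hcontent)
  have hmem := pathStrip_mem_pathDecomposition (x := x) hb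
  have hself := self_mem_pathStrip (x := x) hb
  have hright : ∀ e ∈ pathStrip D x b, boxContent e = boxContent b + 1 →
      e = pathBox x (pathOffset x b) (boxContent b + 1) := by
    intro e he hc
    rw [← (mem_pathStrip.1 he).1, ← hc, pathBox_pathOffset]
  refine ⟨fun ⟨_, h⟩ => ⟨_, hmem, hself, ?_⟩, fun ⟨hc, h⟩ => ⟨_, hmem, hself, ?_⟩⟩
  · by_cases hu : (b.1 - 1, b.2) ∈ D
    · exact .inl (up_mem_pathStrip hb h hu)
    · refine .inr ⟨⟨hself, fun h' => hu (pathStrip_subset h'), fun h' => ?_⟩, hu⟩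
      have := hright _ h' (by simp only [boxContent]; omega)
      rw [pathBox_succ_of_up h] at this
      exact hne' this.symm
  · by_cases hr : (b.1, b.2 + 1) ∈ D
    · exact .inl (right_mem_pathStrip hb h hr)
    · refine .inr ⟨⟨hself, fun h' => ?_, fun h' => hr (pathStrip_subset h')⟩, ?_⟩
      · have := hright _ h' (by simp only [boxContent]; omega)
        rw [pathBox_succ_of_right h] at this
        exact hne' this
      · by_contra hu
        exact hD.content_succ_notMem hb hu hr hc

theorem isTwist_pathCuttingStrip {D : Set Box} {x y : ℤ → ℤ} {i : ℤ}
    (hxy : ∀ c ≠ i, y (c + 1) - y c = x (c + 1) - x c)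
    (hi : x (i + 1) = x i - 1 ↔ y (i + 1) = y i) :
    IsTwist i (pathCuttingStrip D x) (pathCuttingStrip D y) := by
  refine ⟨by simp only [boxContent_image_pathCuttingStrip], fun c hc => ?_, ?_⟩
  · have := hxy c hc
    rw [stripGoesUpAt_pathCuttingStrip, stripGoesUpAt_pathCuttingStrip,
      show x (c + 1) = x c - 1 ↔ y (c + 1) = y c - 1 by omega]
  · rw [stripGoesUpAt_pathCuttingStrip, stripGoesRightAt_pathCuttingStrip, hi]

/-- The box above `b` lies in the strip of `P` containing `b`. -/
def LinkedUp (P : Set (Set Box)) (b : Box) : Prop := ∃ θ ∈ P, b ∈ θ ∧ (b.1 - 1, b.2) ∈ θ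

/-- The box to the right of `b` lies in the strip of `P` containing `b`. -/
def LinkedRight (P : Set (Set Box)) (b : Box) : Prop := ∃ θ ∈ P, b ∈ θ ∧ (b.1, b.2 + 1) ∈ θ

/-- The links of `P` at `b` are compatible with a path going up at `b`. -/
def UpCompatible (D : Set Box) (P : Set (Set Box)) (b : Box) : Prop :=
  ((b.1 - 1, b.2) ∈ D → LinkedUp P b) ∧ ¬LinkedRight P b

/-- The links of `P` at `b` are compatible with a path going right at `b`. -/
def RightCompatible (D : Set Box) (P : Set (Set Box)) (b : Box) : Prop :=
  ((b.1, b.2 + 1) ∈ D → LinkedRight P b) ∧ ¬LinkedUp P b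

namespace IsOutsideDecomposition

variable {D : Set Box} {P : Set (Set Box)}

theorem eq_of_mem (hP : IsOutsideDecomposition D P) {θ θ' : Set Box} (hθ : θ ∈ P) (hθ' : θ' ∈ P)
    {b : Box} (hb : b ∈ θ) (hb' : b ∈ θ') : θ = θ' :=
  (hP.2.1 b ((hP.1 θ hθ).2 hb)).unique ⟨hθ, hb⟩ ⟨hθ', hb'⟩

theorem not_linkedRight_of_linkedUp (hP : IsOutsideDecomposition D P) {b : Box}
    (hu : LinkedUp P b) : ¬LinkedRight P b := by
  rintro ⟨θ', hθ', hb', hr⟩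
  obtain ⟨θ, hθ, hb, hu⟩ := hu
  obtain rfl := hP.eq_of_mem hθ hθ' hb hb'
  have := (hP.1 θ hθ).1.eq_of_content_eq hu hr (by simp only [boxContent]; omega)
  simp at this

theorem linkedUp_or_linkedRight (hP : IsOutsideDecomposition D P) {b : Box} (hb : b ∈ D)
    (hu : (b.1 - 1, b.2) ∈ D) (hr : (b.1, b.2 + 1) ∈ D) : LinkedUp P b ∨ LinkedRight P b := by
  obtain ⟨θ, ⟨hθ, hbθ⟩, -⟩ := hP.2.1 b hb
  by_contra! h
  have := hP.2.2.2 θ hθ b ⟨hbθ, fun h' => h.1 ⟨θ, hθ, hbθ, h'⟩, fun h' => h.2 ⟨θ, hθ, hbθ, h'⟩⟩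
  tauto

theorem linkedRight_or_linkedUp_diag (hP : IsOutsideDecomposition D P) {i j : ℤ}
    (hb : (i, j) ∈ D) (hb' : (i + 1, j + 1) ∈ D) (hr : (i, j + 1) ∈ D) :
    LinkedRight P (i, j) ∨ LinkedUp P (i + 1, j + 1) := by
  obtain ⟨θ, ⟨hθ, hbθ⟩, -⟩ := hP.2.1 _ hr
  by_contra! h
  have := hP.2.2.1 θ hθ _ ⟨hbθ, fun h' => h.1 ⟨θ, hθ, by simpa using h', hbθ⟩,
    fun h' => h.2 ⟨θ, hθ, h', by simpa using hbθ⟩⟩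
  simp only [add_sub_cancel_right] at this
  tauto

theorem not_linkedUp_diag (hP : IsOutsideDecomposition D P) {i j : ℤ}
    (h : LinkedRight P (i, j)) : ¬LinkedUp P (i + 1, j + 1) := by
  rintro ⟨θ', hθ', hb', hu⟩
  obtain ⟨θ, hθ, hb, hr⟩ := h
  simp only [add_sub_cancel_right] at hu
  obtain rfl := hP.eq_of_mem hθ hθ' hr hu
  have := (hP.1 θ hθ).1.eq_of_content_eq hb hb' (by simp only [boxContent]; omega)
  simp at this

theorem upCompatible_or_rightCompatible (hP : IsOutsideDecomposition D P) {b : Box} (hb : b ∈ D) :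
    UpCompatible D P b ∨ RightCompatible D P b := by
  have := hP.not_linkedRight_of_linkedUp (b := b)
  have := hP.linkedUp_or_linkedRight hb
  unfold UpCompatible RightCompatible
  tauto

theorem upCompatible_diag_succ (hP : IsOutsideDecomposition D P) (hD : D.OrdConnected) {i j : ℤ}
    (hb : (i, j) ∈ D) (hb' : (i + 1, j + 1) ∈ D) :
    UpCompatible D P (i, j) ↔ UpCompatible D P (i + 1, j + 1) := by
  have hr : (i, j + 1) ∈ D := hD.out hb hb' ⟨⟨by simp, by simp⟩, ⟨by simp, by simp⟩⟩
  have h1 := hP.not_linkedRight_of_linkedUp (b := (i, j))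
  have h2 := hP.not_linkedRight_of_linkedUp (b := (i + 1, j + 1))
  have h3 := hP.linkedUp_or_linkedRight hb
  have h4 := hP.linkedUp_or_linkedRight hb'
  have h5 := hP.linkedRight_or_linkedUp_diag hb hb' hr
  have h6 := hP.not_linkedUp_diag (i := i) (j := j)
  unfold UpCompatible
  simp only [add_sub_cancel_right] at *
  tauto

theorem upCompatible_congr (hP : IsOutsideDecomposition D P) (hD : D.OrdConnected) {a b : Box}
    (ha : a ∈ D) (hb : b ∈ D) (hab : boxContent a = boxContent b) :
    UpCompatible D P a ↔ UpCompatible D P b := by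
  wlog h : a.1 ≤ b.1 generalizing a b
  · exact (this hb ha hab.symm (by omega)).symm
  obtain ⟨i, j⟩ := a
  obtain ⟨i', j'⟩ := b
  simp only [boxContent] at hab h
  obtain rfl : j' = i' + (j - i) := by omega
  clear hab
  induction i', h using Int.leInduction with
  | base => simp
  | succ i' h ih =>
    have hmem : (i', i' + (j - i)) ∈ D :=
      hD.out ha hb ⟨⟨h, by simp only; omega⟩, ⟨by simp, by simp⟩⟩
    rw [show i' + 1 + (j - i) = i' + (j - i) + 1 by ring] at hb ⊢
    rw [ih hmem, hP.upCompatible_diag_succ hD hmem hb]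

/-- A lattice path whose direction at each non-maximal content is compatible with all the links
of `P` on that diagonal. -/
theorem exists_compatible_path (hP : IsOutsideDecomposition D P) (hfin : D.Finite)
    (hD : D.OrdConnected) : ∃ x : ℤ → ℤ, IsLatticePath x ∧ ∀ b ∈ D,
      (x (boxContent b + 1) = x (boxContent b) - 1 ∧ UpCompatible D P b) ∨
      (x (boxContent b + 1) = x (boxContent b) ∧ RightCompatible D P b) := by
  set U : Set ℤ := {c | ∃ b ∈ D, boxContent b = c ∧ UpCompatible D P b} with hU
  have hUfin : U.Finite := (hfin.image boxContent).subset fun c ⟨b, hb, hc, _⟩ => ⟨b, hb, hc⟩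
  set x : ℤ → ℤ := fun c => ((U ∩ Set.Ici c).ncard : ℤ) with hx
  have hup : ∀ c ∈ U, x (c + 1) = x c - 1 := by
    intro c hc
    have h : U ∩ Set.Ici c = insert c (U ∩ Set.Ici (c + 1)) := by
      ext a
      simp only [Set.mem_inter_iff, Set.mem_Ici, Set.mem_insert_iff]
      constructor
      · rintro ⟨h1, h2⟩
        rcases h2.eq_or_lt with rfl | h2
        · exact .inl rfl
        · exact .inr ⟨h1, by omega⟩
      · rintro (rfl | ⟨h1, h2⟩)
        · exact ⟨hc, le_rfl⟩
        · exact ⟨h1, by omega⟩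
    simp only [hx, h]
    rw [Set.ncard_insert_of_notMem (by simp) (hUfin.inter_of_left _)]
    push_cast
    ring
  have hright : ∀ c ∉ U, x (c + 1) = x c := by
    intro c hc
    have h : U ∩ Set.Ici c = U ∩ Set.Ici (c + 1) := by
      ext a
      simp only [Set.mem_inter_iff, Set.mem_Ici]
      refine and_congr_right fun ha => ⟨fun h => ?_, fun h => by omega⟩
      have : c ≠ a := fun h => hc (h ▸ ha)
      omega
    simp only [hx, h]
  refine ⟨x, fun c => ?_, fun b hb => ?_⟩
  · by_cases hc : c ∈ U
    · exact .inr (hup c hc)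
    · exact .inl (hright c hc)
  · by_cases hc : boxContent b ∈ U
    · obtain ⟨a, ha, hab, hau⟩ := id hc
      exact .inl ⟨hup _ hc, (hP.upCompatible_congr hD ha hb hab).1 hau⟩
    · exact .inr ⟨hright _ hc, (hP.upCompatible_or_rightCompatible hb).resolve_left
        fun h => hc ⟨b, hb, rfl, h⟩⟩

/-- Every outside decomposition is cut out by a lattice path. -/
theorem exists_eq_pathDecomposition (hP : IsOutsideDecomposition D P) (hfin : D.Finite)
    (hD : D.OrdConnected) : ∃ x : ℤ → ℤ, IsLatticePath x ∧ P = pathDecomposition D x := by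
  obtain ⟨x, hx, hcomp⟩ := hP.exists_compatible_path hfin hD
  refine ⟨x, hx, ?_⟩
  have hup : ∀ θ ∈ P, ∀ b ∈ θ, (b.1 - 1, b.2) ∈ θ → (b.1 - 1, b.2) ∈ pathStrip D x b := by
    intro θ hθ b hb hu
    rcases hcomp b ((hP.1 θ hθ).2 hb) with ⟨h, -⟩ | ⟨-, -, h⟩
    · exact up_mem_pathStrip ((hP.1 θ hθ).2 hb) h ((hP.1 θ hθ).2 hu)
    · exact (h ⟨θ, hθ, hb, hu⟩).elim
  have hright : ∀ θ ∈ P, ∀ b ∈ θ, (b.1, b.2 + 1) ∈ θ → (b.1, b.2 + 1) ∈ pathStrip D x b := by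
    intro θ hθ b hb hr
    rcases hcomp b ((hP.1 θ hθ).2 hb) with ⟨-, -, h⟩ | ⟨h, -⟩
    · exact (h ⟨θ, hθ, hb, hr⟩).elim
    · exact right_mem_pathStrip ((hP.1 θ hθ).2 hb) h ((hP.1 θ hθ).2 hr)
  have hadj : ∀ θ ∈ P, ∀ a ∈ θ, ∀ b ∈ θ, boxAdj a b → b ∈ pathStrip D x a := by
    rintro θ hθ ⟨a1, a2⟩ ha ⟨b1, b2⟩ hb (⟨h, h' | h'⟩ | ⟨h, h' | h'⟩) <;> simp only at h h' <;>
      subst h h'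
    · exact pathStrip_symm (hright θ hθ _ hb ha)
    · exact hright θ hθ _ ha hb
    · simpa using hup θ hθ _ ha (by simpa using hb)
    · have := hup θ hθ _ hb (by simpa using ha)
      exact pathStrip_symm (by simpa using this)
  have hstep : ∀ θ ∈ P, ∀ k c, pathBox x k c ∈ D → pathBox x k (c + 1) ∈ D →
      (pathBox x k c ∈ θ ↔ pathBox x k (c + 1) ∈ θ) := by
    intro θ hθ k c h h'
    suffices ∃ θ' ∈ P, pathBox x k c ∈ θ' ∧ pathBox x k (c + 1) ∈ θ' by
      obtain ⟨θ', hθ', h1, h2⟩ := this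
      exact ⟨fun h => hP.eq_of_mem hθ hθ' h h1 ▸ h2, fun h => hP.eq_of_mem hθ hθ' h h2 ▸ h1⟩
    have hc := hcomp _ h
    have hu := @pathBox_succ_of_up x (pathBox x k c)
    have hr := @pathBox_succ_of_right x (pathBox x k c)
    simp only [boxContent_pathBox, pathOffset_pathBox] at hc hu hr
    rcases hc with ⟨hd, h1, -⟩ | ⟨hd, h1, -⟩
    · rw [hu hd] at h' ⊢
      exact h1 h'
    · rw [hr hd] at h' ⊢
      exact h1 h'
  have hpath : ∀ θ ∈ P, ∀ k c d, c ≤ d → (∀ a ∈ Set.Icc c d, pathBox x k a ∈ D) →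
      (pathBox x k c ∈ θ ↔ pathBox x k d ∈ θ) := by
    intro θ hθ k c d hcd h
    induction d, hcd using Int.leInduction with
    | base => rfl
    | succ d hcd ih =>
      rw [ih fun a ha => h a ⟨ha.1, by have := ha.2; omega⟩]
      exact hstep θ hθ k d (h d ⟨hcd, by omega⟩) (h _ ⟨by omega, le_rfl⟩)
  have hstrip : ∀ θ ∈ P, ∀ b ∈ θ, θ = pathStrip D x b := by
    intro θ hθ b hb
    ext e
    constructor
    · intro he
      induction (hP.1 θ hθ).1.2.2.1 b hb e he with
      | refl => exact self_mem_pathStrip ((hP.1 θ hθ).2 hb)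
      | tail _ h ih =>
        exact pathStrip_trans (ih h.1) (hadj θ hθ _ h.1 _ h.2.1 h.2.2)
    · intro he
      rw [mem_pathStrip] at he
      obtain ⟨h1, h2⟩ := he
      rw [← pathBox_pathOffset x b] at hb
      rw [← pathBox_pathOffset x e, h1]
      rcases le_total (boxContent b) (boxContent e) with h | h
      · rw [Set.uIcc_of_le h] at h2
        exact (hpath θ hθ _ _ _ h h2).1 hb
      · rw [Set.uIcc_of_ge h] at h2
        exact (hpath θ hθ _ _ _ h h2).2 hb
  ext θ
  constructor
  · intro hθ
    obtain ⟨b, hb⟩ := (hP.1 θ hθ).1.1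
    exact ⟨b, (hP.1 θ hθ).2 hb, (hstrip θ hθ b hb).symm⟩
  · rintro ⟨b, hb, rfl⟩
    obtain ⟨θ, ⟨hθ, hbθ⟩, -⟩ := hP.2.1 b hb
    exact hstrip θ hθ b hbθ ▸ hθ

end IsOutsideDecomposition

theorem pathDecomposition_congr {D : Set Box} (hD : (boxContent '' D).OrdConnected) {x y : ℤ → ℤ}
    {k : ℤ} (h : ∀ c ∈ boxContent '' D, y c = x c + k) :
    pathDecomposition D y = pathDecomposition D x := by
  refine Set.image_congr fun b hb => Set.ext fun e => ?_
  by_cases he : e ∈ D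
  · have hb' := Set.mem_image_of_mem boxContent hb
    have he' := Set.mem_image_of_mem boxContent he
    rw [mem_pathStrip, mem_pathStrip]
    refine and_congr (by simp only [pathOffset, h _ hb', h _ he']; omega)
      (forall₂_congr fun c hc => ?_)
    have : pathBox y (pathOffset y b) c = pathBox x (pathOffset x b) c := by
      simp only [pathBox, pathOffset, h _ hb', h c (hD.uIcc_subset hb' he' hc), Prod.mk.injEq]
      omega
    rw [this]
  · exact iff_of_false (fun h => he (pathStrip_subset h)) (fun h => he (pathStrip_subset h))

/-- `Q` is obtained from `P` by a twist transformation at the non-maximal content `i` of `D`. -/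
def IsTwistStep (D : Set Box) (i : ℤ) (P Q : Set (Set Box)) : Prop :=
  (i ∈ boxContent '' D ∧ i + 1 ∈ boxContent '' D) ∧
    IsOutsideDecomposition D P ∧ IsOutsideDecomposition D Q ∧
    ∃ S T : Set Box, IsCuttingStripOf D P S ∧ IsCuttingStripOf D Q T ∧ IsTwist i S T

/-- The path following `y` up to content `t` and parallel to `x` afterwards. -/
def splicePath (x y : ℤ → ℤ) (t c : ℤ) : ℤ := if c ≤ t then y c else x c + (y t - x t)

theorem IsLatticePath.splicePath {x y : ℤ → ℤ} (hx : IsLatticePath x) (hy : IsLatticePath y)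
    (t : ℤ) : IsLatticePath (splicePath x y t) := by
  intro c
  unfold _root_.splicePath
  have h1 := hx c
  have h2 := hy c
  rcases lt_trichotomy c t with h | rfl | h
  · rw [if_pos (by omega), if_pos (by omega)]
    omega
  · rw [if_neg (by omega), if_pos (by omega)]
    omega
  · rw [if_neg (by omega), if_neg (by omega)]
    omega

theorem splicePath_sub {x y : ℤ → ℤ} {t c : ℤ} :
    splicePath x y t (c + 1) - splicePath x y t c =
      if c < t then y (c + 1) - y c else x (c + 1) - x c := by
  unfold splicePath
  rcases lt_trichotomy c t with h | rfl | h
  · rw [if_pos (by omega), if_pos (by omega), if_pos h]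
  · rw [if_neg (by omega), if_pos (by omega), if_neg (by omega)]
    omega
  · rw [if_neg (by omega), if_neg (by omega), if_neg (by omega)]
    omega

theorem reflTransGen_isTwistStep_splicePath {D : Set Box} (hD : IsSkewShape D) (hne : D.Nonempty)
    (hconn : EdgewiseConnected D) {x y : ℤ → ℤ} (hx : IsLatticePath x) (hy : IsLatticePath y)
    {m t : ℤ} (hm : m ∈ boxContent '' D) (ht : t ∈ boxContent '' D) (hmt : m ≤ t) :
    Relation.ReflTransGen (fun P Q => ∃ i, IsTwistStep D i P Q)
      (pathDecomposition D (splicePath x y m)) (pathDecomposition D (splicePath x y t)) := by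
  induction t, hmt using Int.leInduction with
  | base => exact .refl
  | succ t hmt ih =>
    have ht' : t ∈ boxContent '' D := hconn.ordConnected_content.out hm ht ⟨hmt, by omega⟩
    refine (ih ht').trans ?_
    have h1 := hx.splicePath hy t
    have h2 := hx.splicePath hy (t + 1)
    by_cases heq : x (t + 1) - x t = y (t + 1) - y t
    · have : splicePath x y (t + 1) = splicePath x y t := by
        funext c
        unfold splicePath
        rcases lt_trichotomy c (t + 1) with h | rfl | h
        · rw [if_pos (by omega), if_pos (by omega)]
        · rw [if_pos (by omega), if_neg (by omega)]
          omega
        · rw [if_neg (by omega), if_neg (by omega)]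
          omega
      rw [this]
    · refine .single ⟨t, ⟨ht', ht⟩, h1.isOutsideDecomposition hD.finite,
        h2.isOutsideDecomposition hD.finite, _, _, h1.isCuttingStripOf hD hne hconn,
        h2.isCuttingStripOf hD hne hconn, isTwist_pathCuttingStrip (fun c hc => ?_) ?_⟩
      · rw [splicePath_sub, splicePath_sub]
        exact if_congr (by omega) rfl rfl
      · have h3 := splicePath_sub (x := x) (y := y) (t := t) (c := t)
        have h4 := splicePath_sub (x := x) (y := y) (t := t + 1) (c := t)
        rw [if_neg (by omega)] at h3
        rw [if_pos (by omega)] at h4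
        have h5 := hx t
        have h6 := hy t
        omega

theorem exists_sequence_of_reflTransGen {α ι : Type*} {r : ι → α → α → Prop} {a b : α}
    (h : Relation.ReflTransGen (fun p q => ∃ i, r i p q) a b) :
    ∃ (s : ℕ) (Q : Fin (s + 1) → α) (f : Fin s → ι),
      Q 0 = a ∧ Q (Fin.last s) = b ∧ ∀ t : Fin s, r (f t) (Q t.castSucc) (Q t.succ) := by
  induction h using Relation.ReflTransGen.head_induction_on with
  | refl => exact ⟨0, fun _ => b, Fin.elim0, rfl, rfl, fun t => t.elim0⟩
  | @head a c hac _ ih =>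
    obtain ⟨i, hi⟩ := hac
    obtain ⟨s, Q, f, h0, hl, hQ⟩ := ih
    refine ⟨s + 1, Fin.cons a Q, Fin.cons i f, rfl, ?_, fun t => ?_⟩
    · rw [← Fin.succ_last, Fin.cons_succ, hl]
    · refine Fin.cases ?_ (fun t => ?_) t
      · simpa [h0] using hi
      · simpa [← Fin.succ_castSucc] using hQ t

/-- Any two outside decompositions of an edgewise connected skew diagram
are connected by a finite sequence of twist transformations `ω_{i_1}, …, ω_{i_s}` at
non-maximal contents. -/
theorem twists_connect_outsideDecompositions
    (D : Set Box) (hD : IsSkewShape D) (hne : D.Nonempty) (hconn : EdgewiseConnected D)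
    (P P' : Set (Set Box))
    (hP : IsOutsideDecomposition D P) (hP' : IsOutsideDecomposition D P') :
    ∃ (s : ℕ) (Q : Fin (s + 1) → Set (Set Box)) (iseq : Fin s → ℤ),
      Q 0 = P ∧ Q (Fin.last s) = P' ∧
      ∀ t : Fin s,
        (iseq t ∈ boxContent '' D ∧ iseq t + 1 ∈ boxContent '' D) ∧
        IsOutsideDecomposition D (Q t.castSucc) ∧
        IsOutsideDecomposition D (Q t.succ) ∧
        ∃ T T' : Set Box, IsCuttingStripOf D (Q t.castSucc) T ∧
          IsCuttingStripOf D (Q t.succ) T' ∧ IsTwist (iseq t) T T' := by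
  obtain ⟨x, hx, rfl⟩ := hP.exists_eq_pathDecomposition hD.finite hD.ordConnected
  obtain ⟨y, hy, rfl⟩ := hP'.exists_eq_pathDecomposition hD.finite hD.ordConnected
  have hfin := hD.finite.image boxContent
  obtain ⟨m, hm, hmin⟩ := Set.exists_min_image _ id hfin (hne.image _)
  obtain ⟨M, hM, hmax⟩ := Set.exists_max_image _ id hfin (hne.image _)
  have h := reflTransGen_isTwistStep_splicePath hD hne hconn hx hy hm hM (hmin M hM)
  have hord := hconn.ordConnected_content
  have hmx : ∀ c ∈ boxContent '' D, splicePath x y m c = x c + (y m - x m) := fun c hc => by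
    have : m ≤ c := hmin c hc
    unfold splicePath
    split_ifs with hcm
    · obtain rfl : c = m := by omega
      omega
    · rfl
  have hMy : ∀ c ∈ boxContent '' D, splicePath x y M c = y c + 0 := fun c hc => by
    have : c ≤ M := hmax c hc
    rw [splicePath, if_pos this, add_zero]
  rw [pathDecomposition_congr hord hmx, pathDecomposition_congr hord hMy] at h
  exact exists_sequence_of_reflTransGen h
end
end
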